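/- arXiv:1708.02641 — 6 statements merged into one kernel-verified Lean document; each statement's English description precedes it below -/
import Mathlib

section
/- Let B be a bialgebra over a field k, A a left B-comodule algebra, V a left Yetter–Drinfeld module over B, and W a relative (A,B)-Hopf module. Then V⊗W, equipped with the action a·(v⊗w) := (a⁽⁻¹⁾·v)⊗(a⁽⁰⁾·w) and the coaction δ(v⊗w) := v₍₋₁₎w₍₋₁₎ ⊗ v₍₀₎⊗w₍₀₎, is again a relative (A,B)-Hopf module: the action is a left A-module structure, the coaction is a left B-comodule structure, and δ(a·(v⊗w)) = a⁽⁻¹⁾(v⊗w)₍₋₁₎ ⊗ a⁽⁰⁾·(v⊗w)₍₀₎ for all a∈A, v∈V, w∈W. -/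
/-!
STATEMENT 1: For a bialgebra `B`, a left `B`-comodule algebra `A`, a left Yetter–Drinfeld
module `V` over `B`, and a relative `(A,B)`-Hopf module `W`, the tensor product `V ⊗ W`
with the action `a·(v⊗w) = (a⁽⁻¹⁾·v)⊗(a⁽⁰⁾·w)` and the coaction
`δ(v⊗w) = v₍₋₁₎w₍₋₁₎ ⊗ v₍₀₎⊗w₍₀₎` is again a relative `(A,B)`-Hopf module.
-/

open scoped TensorProduct

noncomputable section

/-- The `A`-action `a · (v ⊗ w) = (a⁽⁻¹⁾ · v) ⊗ (a⁽⁰⁾ · w)` on `V ⊗ W`. -/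
def hopfAction {k B A V W : Type} [Field k] [Ring B] [Bialgebra k B]
    [Ring A] [Algebra k A] [AddCommGroup V] [Module k V] [AddCommGroup W] [Module k W]
    (δA : A →ₗ[k] B ⊗[k] A) (actV : B →ₗ[k] V →ₗ[k] V) (actW : A →ₗ[k] W →ₗ[k] W) :
    A ⊗[k] (V ⊗[k] W) →ₗ[k] V ⊗[k] W :=
  TensorProduct.map (TensorProduct.lift actV) (TensorProduct.lift actW)
    ∘ₗ (TensorProduct.tensorTensorTensorComm k B A V W).toLinearMap
    ∘ₗ LinearMap.rTensor (V ⊗[k] W) δA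

/-- The tensor product coaction `δ(v ⊗ w) = v₍₋₁₎w₍₋₁₎ ⊗ v₍₀₎ ⊗ w₍₀₎` on `V ⊗ W`. -/
def tensorCoaction {k B V W : Type} [Field k] [Ring B] [Bialgebra k B]
    [AddCommGroup V] [Module k V] [AddCommGroup W] [Module k W]
    (δV : V →ₗ[k] B ⊗[k] V) (δW : W →ₗ[k] B ⊗[k] W) :
    V ⊗[k] W →ₗ[k] B ⊗[k] (V ⊗[k] W) :=
  LinearMap.rTensor (V ⊗[k] W) (LinearMap.mul' k B)
    ∘ₗ (TensorProduct.tensorTensorTensorComm k B V B W).toLinearMap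
    ∘ₗ TensorProduct.map δV δW


section helpers

variable {k B A V W : Type} [Field k] [Ring B] [Bialgebra k B]
    [Ring A] [Algebra k A] [AddCommGroup V] [Module k V] [AddCommGroup W] [Module k W]

/-- The action of `B ⊗ A` on `V ⊗ W`. -/
def tAct (actV : B →ₗ[k] V →ₗ[k] V) (actW : A →ₗ[k] W →ₗ[k] W) :
    (B ⊗[k] A) ⊗[k] (V ⊗[k] W) →ₗ[k] V ⊗[k] W :=
  TensorProduct.map (TensorProduct.lift actV) (TensorProduct.lift actW)
    ∘ₗ (TensorProduct.tensorTensorTensorComm k B A V W).toLinearMap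

/-- `(b ⊗ v) ⊗ (c ⊗ w) ↦ bc ⊗ (v ⊗ w)`. -/
def mMap (k B V W : Type) [Field k] [Ring B] [Bialgebra k B]
    [AddCommGroup V] [Module k V] [AddCommGroup W] [Module k W] :
    (B ⊗[k] V) ⊗[k] (B ⊗[k] W) →ₗ[k] B ⊗[k] (V ⊗[k] W) :=
  LinearMap.rTensor (V ⊗[k] W) (LinearMap.mul' k B)
    ∘ₗ (TensorProduct.tensorTensorTensorComm k B V B W).toLinearMap

/-- `(b ⊗ s) ⊗ (c ⊗ t) ↦ bc ⊗ M(s ⊗ t)`. -/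
def nMap (k B V W : Type) [Field k] [Ring B] [Bialgebra k B]
    [AddCommGroup V] [Module k V] [AddCommGroup W] [Module k W] :
    (B ⊗[k] (B ⊗[k] V)) ⊗[k] (B ⊗[k] (B ⊗[k] W)) →ₗ[k] B ⊗[k] (B ⊗[k] (V ⊗[k] W)) :=
  LinearMap.lTensor B (mMap k B V W) ∘ₗ mMap k B (B ⊗[k] V) (B ⊗[k] W)

/-- `(b ⊗ c) ↦ (b * ·) ⊗ (c · ·)`. -/
def pMap (actV : A →ₗ[k] V →ₗ[k] V) :
    B ⊗[k] A →ₗ[k] (B ⊗[k] V →ₗ[k] B ⊗[k] V) :=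
  TensorProduct.homTensorHomMap (RingHom.id k) B V B V ∘ₗ TensorProduct.map (LinearMap.mul k B) actV

/-- `b ⊗ c ↦ (b·v)₍₋₁₎ c ⊗ (b·v)₍₀₎`. -/
def qMap (actV : B →ₗ[k] V →ₗ[k] V) (δV : V →ₗ[k] B ⊗[k] V) (v : V) :
    B ⊗[k] B →ₗ[k] B ⊗[k] V :=
  TensorProduct.lift ((LinearMap.rTensorHom V ∘ₗ (LinearMap.mul k B).flip).flip
    ∘ₗ δV ∘ₗ actV.flip v)

@[simp] lemma tAct_tmul (actV : B →ₗ[k] V →ₗ[k] V) (actW : A →ₗ[k] W →ₗ[k] W) (b a v w) :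
    tAct actV actW ((b ⊗ₜ[k] a) ⊗ₜ[k] (v ⊗ₜ[k] w)) = actV b v ⊗ₜ actW a w := by
  simp [tAct]

@[simp] lemma mMap_tmul (b c : B) (v : V) (w : W) :
    mMap k B V W ((b ⊗ₜ[k] v) ⊗ₜ[k] (c ⊗ₜ[k] w)) = (b * c) ⊗ₜ (v ⊗ₜ w) := by
  simp [mMap]

@[simp] lemma nMap_tmul (b c : B) (s : B ⊗[k] V) (t : B ⊗[k] W) :
    nMap k B V W ((b ⊗ₜ[k] s) ⊗ₜ[k] (c ⊗ₜ[k] t)) = (b * c) ⊗ₜ mMap k B V W (s ⊗ₜ t) := by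
  simp [nMap]

lemma pMap_tmul (actV : A →ₗ[k] V →ₗ[k] V) (b : B) (a : A) :
    pMap actV (b ⊗ₜ[k] a) = TensorProduct.map (LinearMap.mulLeft k b) (actV a) := by
  ext; simp [pMap]

lemma qMap_tmul (actV : B →ₗ[k] V →ₗ[k] V) (δV : V →ₗ[k] B ⊗[k] V) (v : V) (b c : B) :
    qMap actV δV v (b ⊗ₜ[k] c)
      = LinearMap.rTensor V (LinearMap.mulRight k c) (δV (actV b v)) := by
  have : (LinearMap.mul k B).flip c = LinearMap.mulRight k c := by ext; simp
  simp [qMap, this]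

lemma hopfAction_eq (δA : A →ₗ[k] B ⊗[k] A) (actV : B →ₗ[k] V →ₗ[k] V)
    (actW : A →ₗ[k] W →ₗ[k] W) (a : A) (x : V ⊗[k] W) :
    hopfAction δA actV actW (a ⊗ₜ x) = tAct actV actW (δA a ⊗ₜ x) := by
  simp [hopfAction, tAct]

lemma tensorCoaction_eq (δV : V →ₗ[k] B ⊗[k] V) (δW : W →ₗ[k] B ⊗[k] W) (v : V) (w : W) :
    tensorCoaction δV δW (v ⊗ₜ w) = mMap k B V W (δV v ⊗ₜ δW w) := by
  simp [tensorCoaction, mMap]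

lemma tAct_mul (actV : B →ₗ[k] V →ₗ[k] V) (actW : A →ₗ[k] W →ₗ[k] W)
    (hactVm : ∀ (b b' : B) (v : V), actV (b * b') v = actV b (actV b' v))
    (hactWm : ∀ (a a' : A) (w : W), actW (a * a') w = actW a (actW a' w))
    (s t : B ⊗[k] A) (x : V ⊗[k] W) :
    tAct actV actW ((s * t) ⊗ₜ x) = tAct actV actW (s ⊗ₜ tAct actV actW (t ⊗ₜ x)) := by
  induction s with
  | zero => simp
  | add s s' h h' => simp only [add_mul, TensorProduct.add_tmul, map_add, h, h']
  | tmul b a =>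
  induction t with
  | zero => simp
  | add s s' h h' =>
    simp only [mul_add, TensorProduct.add_tmul, TensorProduct.tmul_add, map_add, h, h']
  | tmul b' a' =>
  induction x with
  | zero => simp
  | add s s' h h' => simp only [TensorProduct.tmul_add, map_add, h, h']
  | tmul v w => simp [hactVm, hactWm]

lemma assoc_mMap (p q : B ⊗[k] B) (v : V) (w : W) :
    TensorProduct.assoc k B B (V ⊗[k] W) ((p * q) ⊗ₜ (v ⊗ₜ w))
      = nMap k B V W (TensorProduct.assoc k B B V (p ⊗ₜ v) ⊗ₜ
          TensorProduct.assoc k B B W (q ⊗ₜ w)) := by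
  induction p with
  | zero => simp
  | add s s' h h' => simp only [add_mul, TensorProduct.add_tmul, map_add, h, h']
  | tmul b a =>
  induction q with
  | zero => simp
  | add s s' h h' =>
    simp only [mul_add, TensorProduct.add_tmul, TensorProduct.tmul_add, map_add, h, h']
  | tmul b' a' => simp

lemma comul_mMap (s : B ⊗[k] V) (t : B ⊗[k] W) :
    TensorProduct.assoc k B B (V ⊗[k] W)
      (LinearMap.rTensor (V ⊗[k] W) (Coalgebra.comul (R := k)) (mMap k B V W (s ⊗ₜ t)))
      = nMap k B V W
        (TensorProduct.assoc k B B V (LinearMap.rTensor V (Coalgebra.comul (R := k)) s) ⊗ₜ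
          TensorProduct.assoc k B B W (LinearMap.rTensor W (Coalgebra.comul (R := k)) t)) := by
  induction s with
  | zero => simp
  | add s s' h h' => simp only [TensorProduct.add_tmul, map_add, h, h']
  | tmul b v =>
  induction t with
  | zero => simp
  | add s s' h h' => simp only [TensorProduct.tmul_add, map_add, h, h']
  | tmul c w =>
    rw [mMap_tmul, LinearMap.rTensor_tmul, LinearMap.rTensor_tmul, LinearMap.rTensor_tmul,
      Bialgebra.comul_mul, assoc_mMap]

lemma lTensor_mMap (δV : V →ₗ[k] B ⊗[k] V) (δW : W →ₗ[k] B ⊗[k] W)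
    (s : B ⊗[k] V) (t : B ⊗[k] W) :
    LinearMap.lTensor B (tensorCoaction δV δW) (mMap k B V W (s ⊗ₜ t))
      = nMap k B V W (LinearMap.lTensor B δV s ⊗ₜ LinearMap.lTensor B δW t) := by
  induction s with
  | zero => simp
  | add s s' h h' => simp only [TensorProduct.add_tmul, map_add, h, h']
  | tmul b v =>
  induction t with
  | zero => simp
  | add s s' h h' => simp only [TensorProduct.tmul_add, map_add, h, h']
  | tmul c w => simp [tensorCoaction_eq]

lemma counit_mMap (s : B ⊗[k] V) (t : B ⊗[k] W) :
    TensorProduct.lid k (V ⊗[k] W)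
      (LinearMap.rTensor (V ⊗[k] W) (Coalgebra.counit (R := k)) (mMap k B V W (s ⊗ₜ t)))
      = TensorProduct.lid k V (LinearMap.rTensor V (Coalgebra.counit (R := k)) s) ⊗ₜ
          TensorProduct.lid k W (LinearMap.rTensor W (Coalgebra.counit (R := k)) t) := by
  induction s with
  | zero => simp
  | add s s' h h' => simp only [TensorProduct.add_tmul, map_add, h, h']
  | tmul b v =>
  induction t with
  | zero => simp
  | add s s' h h' => simp only [TensorProduct.tmul_add, map_add, h, h']
  | tmul c w => simp [← TensorProduct.smul_tmul', smul_smul, mul_comm]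

/-- `b ⊗ (c ⊗ a) ↦ M((b ⊗ c) s ⊗ a t)`. -/
def fMap (actV : B →ₗ[k] V →ₗ[k] V) (actW : A →ₗ[k] W →ₗ[k] W)
    (s : B ⊗[k] V) (t : B ⊗[k] W) : B ⊗[k] (B ⊗[k] A) →ₗ[k] B ⊗[k] (V ⊗[k] W) :=
  mMap k B V W ∘ₗ TensorProduct.map ((pMap actV).flip s)
    ((LinearMap.lTensorHom B ∘ₗ actW).flip t) ∘ₗ (TensorProduct.assoc k B B A).symm.toLinearMap

lemma fMap_assoc (actV : B →ₗ[k] V →ₗ[k] V) (actW : A →ₗ[k] W →ₗ[k] W)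
    (s : B ⊗[k] V) (t : B ⊗[k] W) (z : B ⊗[k] B) (a : A) :
    fMap actV actW s t (TensorProduct.assoc k B B A (z ⊗ₜ a))
      = mMap k B V W (pMap actV z s ⊗ₜ LinearMap.lTensor B (actW a) t) := by
  simp [fMap]

/-- `b ⊗ y ↦ M(δ(b v) ⊗ y t)`. -/
def gMap (actV : B →ₗ[k] V →ₗ[k] V) (actW : A →ₗ[k] W →ₗ[k] W) (δV : V →ₗ[k] B ⊗[k] V)
    (v : V) (t : B ⊗[k] W) : B ⊗[k] (B ⊗[k] A) →ₗ[k] B ⊗[k] (V ⊗[k] W) :=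
  mMap k B V W ∘ₗ TensorProduct.map (δV ∘ₗ actV.flip v) ((pMap actW).flip t)

lemma mMap_shift (s : B ⊗[k] V) (t : B ⊗[k] W) (c : B) (f : W →ₗ[k] W) :
    mMap k B V W (s ⊗ₜ TensorProduct.map (LinearMap.mulLeft k c) f t)
      = mMap k B V W (LinearMap.rTensor V (LinearMap.mulRight k c) s ⊗ₜ
        LinearMap.lTensor B f t) := by
  induction s with
  | zero => simp
  | add s s' h h' => simp only [TensorProduct.add_tmul, map_add, h, h']
  | tmul b v =>
  induction t with
  | zero => simp
  | add s s' h h' => simp only [TensorProduct.tmul_add, map_add, h, h']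
  | tmul c w => simp [mul_assoc]

lemma gMap_assoc (actV : B →ₗ[k] V →ₗ[k] V) (actW : A →ₗ[k] W →ₗ[k] W) (δV : V →ₗ[k] B ⊗[k] V)
    (v : V) (t : B ⊗[k] W) (z : B ⊗[k] B) (a : A) :
    gMap actV actW δV v t (TensorProduct.assoc k B B A (z ⊗ₜ a))
      = mMap k B V W (qMap actV δV v z ⊗ₜ LinearMap.lTensor B (actW a) t) := by
  induction z with
  | zero => simp
  | add s s' h h' => simp only [TensorProduct.add_tmul, map_add, h, h']
  | tmul b c => simp [gMap, pMap_tmul, qMap_tmul, mMap_shift]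

lemma fMap_tmul (actV : B →ₗ[k] V →ₗ[k] V) (actW : A →ₗ[k] W →ₗ[k] W)
    (s : B ⊗[k] V) (t : B ⊗[k] W) (b : B) (y : B ⊗[k] A) :
    fMap actV actW s t (b ⊗ₜ y) = TensorProduct.map (LinearMap.mulLeft k b)
      (tAct actV actW ∘ₗ TensorProduct.mk k (B ⊗[k] A) (V ⊗[k] W) y) (mMap k B V W (s ⊗ₜ t)) := by
  induction y with
  | zero => simp
  | add s s' h h' =>
    simp only [TensorProduct.tmul_add, map_add, h, h', LinearMap.comp_add,
      TensorProduct.map_add_right, LinearMap.add_apply]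
  | tmul c a =>
  have := fMap_assoc actV actW s t (b ⊗ₜ c) a
  rw [TensorProduct.assoc_tmul] at this
  rw [this, pMap_tmul]
  clear this
  induction s with
  | zero => simp
  | add s s' h h' => simp only [TensorProduct.add_tmul, map_add, h, h']
  | tmul b v =>
  induction t with
  | zero => simp
  | add s s' h h' => simp only [TensorProduct.tmul_add, map_add, h, h']
  | tmul c w => simp [mul_assoc]

end helpers

theorem relative_hopf_module_tensor_action
    {k B A V W : Type} [Field k] [Ring B] [Bialgebra k B]
    [Ring A] [Algebra k A] [AddCommGroup V] [Module k V] [AddCommGroup W] [Module k W]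
    -- `A` is a left `B`-comodule algebra
    (δA : A →ₗ[k] B ⊗[k] A)
    (hδA1 : ∀ a : A, (TensorProduct.assoc k B B A)
        ((LinearMap.rTensor A (Coalgebra.comul (R := k))) (δA a))
        = (LinearMap.lTensor B δA) (δA a))
    (hδA2 : ∀ a : A, (TensorProduct.lid k A)
        ((LinearMap.rTensor A (Coalgebra.counit (R := k))) (δA a)) = a)
    (hδAalg : ∀ a a' : A, δA (a * a') = δA a * δA a')
    (hδAone : δA 1 = 1)
    -- `V` is a left Yetter–Drinfeld module over `B`
    (actV : B →ₗ[k] V →ₗ[k] V)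
    (hactV1 : ∀ v : V, actV 1 v = v)
    (hactVm : ∀ (b b' : B) (v : V), actV (b * b') v = actV b (actV b' v))
    (δV : V →ₗ[k] B ⊗[k] V)
    (hδV1 : ∀ v : V, (TensorProduct.assoc k B B V)
        ((LinearMap.rTensor V (Coalgebra.comul (R := k))) (δV v))
        = (LinearMap.lTensor B δV) (δV v))
    (hδV2 : ∀ v : V, (TensorProduct.lid k V)
        ((LinearMap.rTensor V (Coalgebra.counit (R := k))) (δV v)) = v)
    (hYD : ∀ (b : B) (v : V) (n : ℕ) (b1 b2 : Fin n → B),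
      Coalgebra.comul (R := k) b = ∑ i, b1 i ⊗ₜ[k] b2 i →
      ∑ i, TensorProduct.map (LinearMap.mulLeft k (b1 i)) (actV (b2 i)) (δV v)
        = ∑ i, LinearMap.rTensor V (LinearMap.mulRight k (b2 i)) (δV (actV (b1 i) v)))
    -- `W` is a relative `(A,B)`-Hopf module
    (actW : A →ₗ[k] W →ₗ[k] W)
    (hactW1 : ∀ w : W, actW 1 w = w)
    (hactWm : ∀ (a a' : A) (w : W), actW (a * a') w = actW a (actW a' w))
    (δW : W →ₗ[k] B ⊗[k] W)
    (hδW1 : ∀ w : W, (TensorProduct.assoc k B B W)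
        ((LinearMap.rTensor W (Coalgebra.comul (R := k))) (δW w))
        = (LinearMap.lTensor B δW) (δW w))
    (hδW2 : ∀ w : W, (TensorProduct.lid k W)
        ((LinearMap.rTensor W (Coalgebra.counit (R := k))) (δW w)) = w)
    (hRelHopf : ∀ (a : A) (w : W) (n : ℕ) (a1 : Fin n → B) (a0 : Fin n → A),
      δA a = ∑ i, a1 i ⊗ₜ[k] a0 i →
      δW (actW a w) = ∑ i, TensorProduct.map (LinearMap.mulLeft k (a1 i)) (actW (a0 i)) (δW w)) :
    -- the action is a left `A`-module structure on `V ⊗ W`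
    (∀ x : V ⊗[k] W, hopfAction δA actV actW ((1 : A) ⊗ₜ[k] x) = x) ∧
    (∀ (a a' : A) (x : V ⊗[k] W),
      hopfAction δA actV actW ((a * a') ⊗ₜ[k] x)
        = hopfAction δA actV actW (a ⊗ₜ[k] hopfAction δA actV actW (a' ⊗ₜ[k] x))) ∧
    -- the coaction is a left `B`-comodule structure on `V ⊗ W`
    (∀ x : V ⊗[k] W, (TensorProduct.assoc k B B (V ⊗[k] W))
        ((LinearMap.rTensor (V ⊗[k] W) (Coalgebra.comul (R := k))) (tensorCoaction δV δW x))
        = (LinearMap.lTensor B (tensorCoaction δV δW)) (tensorCoaction δV δW x)) ∧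
    (∀ x : V ⊗[k] W, (TensorProduct.lid k (V ⊗[k] W))
        ((LinearMap.rTensor (V ⊗[k] W) (Coalgebra.counit (R := k))) (tensorCoaction δV δW x))
        = x) ∧
    -- the relative Hopf compatibility `δ(a·x) = a⁽⁻¹⁾x₍₋₁₎ ⊗ a⁽⁰⁾·x₍₀₎`
    (∀ (a : A) (x : V ⊗[k] W) (n : ℕ) (a1 : Fin n → B) (a0 : Fin n → A),
      δA a = ∑ i, a1 i ⊗ₜ[k] a0 i →
      tensorCoaction δV δW (hopfAction δA actV actW (a ⊗ₜ[k] x))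
        = ∑ i, TensorProduct.map (LinearMap.mulLeft k (a1 i))
            (hopfAction δA actV actW ∘ₗ TensorProduct.mk k A (V ⊗[k] W) (a0 i))
            (tensorCoaction δV δW x)) := by
  have hYD' : ∀ (b : B) (v : V), pMap actV (Coalgebra.comul (R := k) b) (δV v)
      = qMap actV δV v (Coalgebra.comul (R := k) b) := by
    intro b v
    obtain ⟨n, b1, b2, h⟩ := TensorProduct.exists_sum_tmul_eq (Coalgebra.comul (R := k) b)
    have := hYD b v n b1 b2 h
    rw [h]
    simpa only [map_sum, LinearMap.sum_apply, pMap_tmul, qMap_tmul] using this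
  have hW' : ∀ (a : A) (w : W), δW (actW a w) = pMap actW (δA a) (δW w) := by
    intro a w
    obtain ⟨n, a1, a0, h⟩ := TensorProduct.exists_sum_tmul_eq (δA a)
    rw [hRelHopf a w n a1 a0 h, h]
    simp only [map_sum, LinearMap.sum_apply, pMap_tmul]
  refine ⟨?_, ?_, ?_, ?_, ?_⟩
  · intro x
    rw [hopfAction_eq, hδAone, Algebra.TensorProduct.one_def]
    induction x with
    | zero => simp
    | add s s' h h' => rw [TensorProduct.tmul_add, map_add, h, h']
    | tmul v w => simp [hactV1, hactW1]
  · intro a a' x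
    simp only [hopfAction_eq]
    rw [hδAalg, tAct_mul actV actW hactVm hactWm]
  · intro x
    induction x with
    | zero => simp
    | add s s' h h' => simp only [map_add, h, h']
    | tmul v w => rw [tensorCoaction_eq, comul_mMap, lTensor_mMap, hδV1, hδW1]
  · intro x
    induction x with
    | zero => simp
    | add s s' h h' => simp only [map_add, h, h']
    | tmul v w => rw [tensorCoaction_eq, counit_mMap, hδV2, hδW2]
  · intro a x n a1 a0 ha
    induction x with
    | zero => simp
    | add s s' h h' => simp only [TensorProduct.tmul_add, map_add, h, h', Finset.sum_add_distrib]
    | tmul v w =>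
    have hR : ∀ i, TensorProduct.map (LinearMap.mulLeft k (a1 i))
            (hopfAction δA actV actW ∘ₗ TensorProduct.mk k A (V ⊗[k] W) (a0 i))
            (tensorCoaction δV δW (v ⊗ₜ w))
        = fMap actV actW (δV v) (δW w) (a1 i ⊗ₜ δA (a0 i)) := by
      intro i
      have : hopfAction δA actV actW ∘ₗ TensorProduct.mk k A (V ⊗[k] W) (a0 i)
          = tAct actV actW ∘ₗ TensorProduct.mk k (B ⊗[k] A) (V ⊗[k] W) (δA (a0 i)) := by
        apply LinearMap.ext
        intro y
        simp [hopfAction_eq]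
      rw [fMap_tmul, this, tensorCoaction_eq]
    have hL : ∀ i, tensorCoaction δV δW (tAct actV actW ((a1 i ⊗ₜ a0 i) ⊗ₜ (v ⊗ₜ w)))
        = gMap actV actW δV v (δW w) (a1 i ⊗ₜ δA (a0 i)) := by
      intro i
      rw [tAct_tmul, tensorCoaction_eq, hW']
      simp [gMap]
    have hco : ∑ i, a1 i ⊗ₜ[k] δA (a0 i)
        = ∑ i, TensorProduct.assoc k B B A (Coalgebra.comul (R := k) (a1 i) ⊗ₜ a0 i) := by
      have := hδA1 a
      rw [ha] at this
      simpa only [map_sum, LinearMap.rTensor_tmul, LinearMap.lTensor_tmul] using this.symm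
    rw [hopfAction_eq, ha, TensorProduct.sum_tmul, map_sum, map_sum]
    simp only [hL, hR]
    rw [← map_sum, ← map_sum, hco, map_sum, map_sum]
    simp only [gMap_assoc, fMap_assoc, hYD']

end
end

section
/- Let B be a bialgebra over a field k, A a right B-module algebra, V a right Yetter–Drinfeld module over B, and W a k-vector space which is a left A-module (a·w) and a right B-module (w◁b) satisfying (a·w)◁b = (a◁b₍₁₎)·(w◁b₍₂₎). Then V⊗W, equipped with the A-action a·(v⊗w) := v₍₀₎ ⊗ ((a◁v₍₁₎)·w) and the B-action (v⊗w)◁b := (v◁b₍₁₎) ⊗ (w◁b₍₂₎), is again a left A-module and right B-module satisfying (a·(v⊗w))◁b = (a◁b₍₁₎)·((v⊗w)◁b₍₂₎). -/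
/-!
STATEMENT 2: For a bialgebra `B`, a right `B`-module algebra `A`, a right Yetter–Drinfeld
module `V`, and a space `W` which is a left `A`-module and right `B`-module with
`(a·w)◁b = (a◁b₍₁₎)·(w◁b₍₂₎)`, the tensor product `V ⊗ W` with
`a·(v⊗w) = v₍₀₎ ⊗ ((a◁v₍₁₎)·w)` and `(v⊗w)◁b = (v◁b₍₁₎) ⊗ (w◁b₍₂₎)` satisfies
the same compatibilities.

Right actions `x ◁ b` are encoded as curried maps `r_ : B →ₗ _ →ₗ _` with `r_ b x = x ◁ b`.
-/

open scoped TensorProduct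

noncomputable section

/-- The `A`-action `a · (v ⊗ w) = v₍₀₎ ⊗ ((a ◁ v₍₁₎) · w)` on `V ⊗ W`. -/
def inducedAAction {k B A V W : Type} [Field k] [Ring B] [Bialgebra k B]
    [Ring A] [Algebra k A] [AddCommGroup V] [Module k V] [AddCommGroup W] [Module k W]
    (δV : V →ₗ[k] V ⊗[k] B) (rA : B →ₗ[k] A →ₗ[k] A) (actW : A →ₗ[k] W →ₗ[k] W) :
    A ⊗[k] (V ⊗[k] W) →ₗ[k] V ⊗[k] W :=
  LinearMap.lTensor V (TensorProduct.lift actW)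
    ∘ₗ LinearMap.lTensor V (LinearMap.rTensor W (TensorProduct.lift rA))
    ∘ₗ (TensorProduct.assoc k V (B ⊗[k] A) W).toLinearMap
    ∘ₗ LinearMap.rTensor W (LinearMap.lTensor V (TensorProduct.comm k A B).toLinearMap)
    ∘ₗ LinearMap.rTensor W (TensorProduct.assoc k V A B).toLinearMap
    ∘ₗ LinearMap.rTensor W (LinearMap.rTensor B (TensorProduct.comm k A V).toLinearMap)
    ∘ₗ LinearMap.rTensor W (TensorProduct.assoc k A V B).symm.toLinearMap
    ∘ₗ (TensorProduct.assoc k A (V ⊗[k] B) W).symm.toLinearMap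
    ∘ₗ LinearMap.lTensor A (LinearMap.rTensor W δV)

/-- The right `B`-action `(v ⊗ w) ◁ b = (v ◁ b₍₁₎) ⊗ (w ◁ b₍₂₎)` on `V ⊗ W`. -/
def tensorRightAction {k B V W : Type} [Field k] [Ring B] [Bialgebra k B]
    [AddCommGroup V] [Module k V] [AddCommGroup W] [Module k W]
    (rV : B →ₗ[k] V →ₗ[k] V) (rW : B →ₗ[k] W →ₗ[k] W) :
    (V ⊗[k] W) ⊗[k] B →ₗ[k] V ⊗[k] W :=
  TensorProduct.map (TensorProduct.lift rV.flip) (TensorProduct.lift rW.flip)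
    ∘ₗ (TensorProduct.tensorTensorTensorComm k V W B B).toLinearMap
    ∘ₗ LinearMap.lTensor (V ⊗[k] W) (Coalgebra.comul (R := k))

section Helpers

variable {k B A V W : Type} [Field k] [Ring B] [Bialgebra k B]
    [Ring A] [Algebra k A] [AddCommGroup V] [Module k V] [AddCommGroup W] [Module k W]

theorem aux_repr {M N : Type} [AddCommGroup M] [Module k M] [AddCommGroup N] [Module k N]
    (t : M ⊗[k] N) : ∃ (n : ℕ) (x : Fin n → M) (y : Fin n → N), t = ∑ i, x i ⊗ₜ[k] y i := by
  induction t with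
  | zero => exact ⟨0, Fin.elim0, Fin.elim0, by simp⟩
  | tmul x y => exact ⟨1, fun _ => x, fun _ => y, by simp⟩
  | add s t hs ht =>
    obtain ⟨n, x, y, rfl⟩ := hs
    obtain ⟨m, x', y', rfl⟩ := ht
    exact ⟨n + m, Fin.append x x', Fin.append y y', by simp [Fin.sum_univ_add]⟩

theorem ind_tmul (δV : V →ₗ[k] V ⊗[k] B) (rA : B →ₗ[k] A →ₗ[k] A) (actW : A →ₗ[k] W →ₗ[k] W)
    (a : A) (v : V) (w : W) :
    inducedAAction δV rA actW (a ⊗ₜ[k] (v ⊗ₜ[k] w))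
      = LinearMap.lTensor V (actW.flip w ∘ₗ rA.flip a) (δV v) := by
  simp only [inducedAAction, LinearMap.comp_apply, LinearMap.lTensor_tmul, LinearMap.rTensor_tmul]
  generalize δV v = t
  induction t with
  | zero => simp
  | tmul x y => simp
  | add s t hs ht => simp only [TensorProduct.add_tmul, TensorProduct.tmul_add, map_add, hs, ht]

theorem tra_tmul (rV : B →ₗ[k] V →ₗ[k] V) (rW : B →ₗ[k] W →ₗ[k] W) (v : V) (w : W) (b : B) :
    tensorRightAction rV rW ((v ⊗ₜ[k] w) ⊗ₜ[k] b)
      = TensorProduct.map (rV.flip v) (rW.flip w) (Coalgebra.comul (R := k) b) := by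
  simp only [tensorRightAction, LinearMap.comp_apply, LinearMap.lTensor_tmul]
  generalize (Coalgebra.comul (R := k) b) = t
  induction t with
  | zero => simp
  | tmul x y => simp
  | add s t hs ht => simp only [TensorProduct.tmul_add, map_add, hs, ht]

/-- `x ⊗ y ↦ (v₍₀₎ ◁ x) ⊗ v₍₁₎ y`. -/
def auxP (rV : B →ₗ[k] V →ₗ[k] V) (t : V ⊗[k] B) : B ⊗[k] B →ₗ[k] V ⊗[k] B :=
  TensorProduct.lift
    (((TensorProduct.mapBilinear (RingHom.id k) V B V B).compl₁₂ rV
      (LinearMap.mul k B).flip).compr₂ (LinearMap.applyₗ t))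

/-- `x ⊗ y ↦ (v ◁ y)₍₀₎ ⊗ x (v ◁ y)₍₁₎`. -/
def auxQ (rV : B →ₗ[k] V →ₗ[k] V) (δV : V →ₗ[k] V ⊗[k] B) (v : V) :
    B ⊗[k] B →ₗ[k] V ⊗[k] B :=
  TensorProduct.lift
    ((LinearMap.lTensorHom V ∘ₗ LinearMap.mul k B).compl₂ (δV ∘ₗ rV.flip v))

/-- `z ↦ (v ⊗ β ↦ v ⊗ (a ◁ β) · (w ◁ z))`. -/
def auxS (rA : B →ₗ[k] A →ₗ[k] A) (actW : A →ₗ[k] W →ₗ[k] W) (rW : B →ₗ[k] W →ₗ[k] W)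
    (a : A) (w : W) : B →ₗ[k] (V ⊗[k] B →ₗ[k] V ⊗[k] W) :=
  LinearMap.lTensorHom V ∘ₗ (LinearMap.lcomp k W (rA.flip a)) ∘ₗ actW.flip ∘ₗ rW.flip w

theorem auxP_tmul (rV : B →ₗ[k] V →ₗ[k] V) (t : V ⊗[k] B) (x y : B) :
    auxP rV t (x ⊗ₜ y) = TensorProduct.map (rV x) (LinearMap.mulRight k y) t := rfl

theorem auxQ_tmul (rV : B →ₗ[k] V →ₗ[k] V) (δV : V →ₗ[k] V ⊗[k] B) (v : V) (x y : B) :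
    auxQ rV δV v (x ⊗ₜ y) = LinearMap.lTensor V (LinearMap.mulLeft k x) (δV (rV y v)) := rfl

theorem auxS_apply (rA : B →ₗ[k] A →ₗ[k] A) (actW : A →ₗ[k] W →ₗ[k] W) (rW : B →ₗ[k] W →ₗ[k] W)
    (a : A) (w : W) (z : B) :
    auxS (V := V) rA actW rW a w z
      = LinearMap.lTensor V (actW.flip (rW z w) ∘ₗ rA.flip a) := rfl

theorem auxP_add (rV : B →ₗ[k] V →ₗ[k] V) (s t : V ⊗[k] B) :
    auxP rV (s + t) = auxP rV s + auxP rV t := by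
  ext x y
  simp [auxP_tmul]

theorem auxP_zero (rV : B →ₗ[k] V →ₗ[k] V) : auxP rV (0 : V ⊗[k] B) = 0 := by
  ext x y
  simp [auxP_tmul]

end Helpers

theorem tensor_action_right_module_algebra
    {k B A V W : Type} [Field k] [Ring B] [Bialgebra k B]
    [Ring A] [Algebra k A] [AddCommGroup V] [Module k V] [AddCommGroup W] [Module k W]
    -- `A` is a right `B`-module algebra
    (rA : B →ₗ[k] A →ₗ[k] A)
    (hrA1 : ∀ a : A, rA 1 a = a)
    (hrAm : ∀ (b b' : B) (a : A), rA b' (rA b a) = rA (b * b') a)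
    (hrAalg : ∀ (a a' : A) (b : B) (n : ℕ) (b1 b2 : Fin n → B),
      Coalgebra.comul (R := k) b = ∑ i, b1 i ⊗ₜ[k] b2 i →
      rA b (a * a') = ∑ i, rA (b1 i) a * rA (b2 i) a')
    (hrAone : ∀ b : B, rA b (1 : A) = Coalgebra.counit (R := k) b • (1 : A))
    -- `V` is a right Yetter–Drinfeld module over `B`
    (rV : B →ₗ[k] V →ₗ[k] V)
    (hrV1 : ∀ v : V, rV 1 v = v)
    (hrVm : ∀ (b b' : B) (v : V), rV b' (rV b v) = rV (b * b') v)
    (δV : V →ₗ[k] V ⊗[k] B)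
    (hδV1 : ∀ v : V, (TensorProduct.assoc k V B B)
        ((LinearMap.rTensor B δV) (δV v))
        = (LinearMap.lTensor V (Coalgebra.comul (R := k))) (δV v))
    (hδV2 : ∀ v : V, (TensorProduct.rid k V)
        ((LinearMap.lTensor V (Coalgebra.counit (R := k))) (δV v)) = v)
    (hYD : ∀ (b : B) (v : V) (n : ℕ) (b1 b2 : Fin n → B),
      Coalgebra.comul (R := k) b = ∑ i, b1 i ⊗ₜ[k] b2 i →
      ∑ i, TensorProduct.map (rV (b1 i)) (LinearMap.mulRight k (b2 i)) (δV v)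
        = ∑ i, LinearMap.lTensor V (LinearMap.mulLeft k (b1 i)) (δV (rV (b2 i) v)))
    -- `W` is a left `A`-module and a right `B`-module with compatibility
    (actW : A →ₗ[k] W →ₗ[k] W)
    (hactW1 : ∀ w : W, actW 1 w = w)
    (hactWm : ∀ (a a' : A) (w : W), actW (a * a') w = actW a (actW a' w))
    (rW : B →ₗ[k] W →ₗ[k] W)
    (hrW1 : ∀ w : W, rW 1 w = w)
    (hrWm : ∀ (b b' : B) (w : W), rW b' (rW b w) = rW (b * b') w)
    (hWcompat : ∀ (a : A) (w : W) (b : B) (n : ℕ) (b1 b2 : Fin n → B),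
      Coalgebra.comul (R := k) b = ∑ i, b1 i ⊗ₜ[k] b2 i →
      rW b (actW a w) = ∑ i, actW (rA (b1 i) a) (rW (b2 i) w)) :
    -- `V ⊗ W` is a left `A`-module
    (∀ x : V ⊗[k] W, inducedAAction δV rA actW ((1 : A) ⊗ₜ[k] x) = x) ∧
    (∀ (a a' : A) (x : V ⊗[k] W),
      inducedAAction δV rA actW ((a * a') ⊗ₜ[k] x)
        = inducedAAction δV rA actW (a ⊗ₜ[k] inducedAAction δV rA actW (a' ⊗ₜ[k] x))) ∧
    -- `V ⊗ W` is a right `B`-module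
    (∀ x : V ⊗[k] W, tensorRightAction rV rW (x ⊗ₜ[k] (1 : B)) = x) ∧
    (∀ (b b' : B) (x : V ⊗[k] W),
      tensorRightAction rV rW (tensorRightAction rV rW (x ⊗ₜ[k] b) ⊗ₜ[k] b')
        = tensorRightAction rV rW (x ⊗ₜ[k] (b * b'))) ∧
    -- the compatibility `(a·x)◁b = (a◁b₍₁₎)·(x◁b₍₂₎)`
    (∀ (a : A) (x : V ⊗[k] W) (b : B) (n : ℕ) (b1 b2 : Fin n → B),
      Coalgebra.comul (R := k) b = ∑ i, b1 i ⊗ₜ[k] b2 i →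
      tensorRightAction rV rW (inducedAAction δV rA actW (a ⊗ₜ[k] x) ⊗ₜ[k] b)
        = ∑ i, inducedAAction δV rA actW
            ((rA (b1 i) a) ⊗ₜ[k] tensorRightAction rV rW (x ⊗ₜ[k] b2 i))) := by
  refine ⟨?_, ?_, ?_, ?_, ?_⟩
  · intro x
    induction x with
    | zero => simp
    | add s t hs ht => simp only [TensorProduct.tmul_add, map_add, hs, ht]
    | tmul v w =>
      rw [ind_tmul]
      have key : ∀ t : V ⊗[k] B, LinearMap.lTensor V (actW.flip w ∘ₗ rA.flip 1) t
          = (TensorProduct.rid k V)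
            ((LinearMap.lTensor V (Coalgebra.counit (R := k))) t) ⊗ₜ[k] w := by
        intro t
        induction t with
        | zero => simp
        | add s t hs ht => simp only [TensorProduct.add_tmul, map_add, hs, ht]
        | tmul x y => simp [hrAone, hactW1, TensorProduct.smul_tmul]
      rw [key, hδV2]
  · intro a a' x
    induction x with
    | zero => simp
    | add s t hs ht => simp only [TensorProduct.tmul_add, map_add, hs, ht]
    | tmul v w =>
      rw [ind_tmul, ind_tmul]
      let G : B ⊗[k] B →ₗ[k] W := TensorProduct.lift
        (actW.compl₁₂ (rA.flip a) (actW.flip w ∘ₗ rA.flip a'))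
      have hG : ∀ x y, G (x ⊗ₜ y) = actW (rA x a) (actW (rA y a') w) := fun x y => rfl
      have key : ∀ t : V ⊗[k] B, inducedAAction δV rA actW
          (a ⊗ₜ[k] LinearMap.lTensor V (actW.flip w ∘ₗ rA.flip a') t)
          = LinearMap.lTensor V G (TensorProduct.assoc k V B B (LinearMap.rTensor B δV t)) := by
        intro t
        induction t with
        | zero => simp
        | add s t hs ht => simp only [TensorProduct.tmul_add, map_add, hs, ht]
        | tmul x y =>
          rw [LinearMap.lTensor_tmul, ind_tmul, LinearMap.rTensor_tmul]
          generalize δV x = s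
          induction s with
          | zero => simp
          | add s t hs ht => simp only [TensorProduct.add_tmul, map_add, hs, ht]
          | tmul p q => simp [hG]
      rw [key, hδV1, ← LinearMap.lTensor_comp_apply]
      congr 2
      ext b
      obtain ⟨n, b1, b2, hb⟩ := aux_repr (Coalgebra.comul (R := k) b)
      simp [hb, hG, hrAalg a a' b n b1 b2 hb, hactWm]
  · intro x
    induction x with
    | zero => simp
    | add s t hs ht => simp only [TensorProduct.add_tmul, map_add, hs, ht]
    | tmul v w =>
      rw [tra_tmul]
      simp [Algebra.TensorProduct.one_def, hrV1, hrW1]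
  · intro b b' x
    induction x with
    | zero => simp
    | add s t hs ht => simp only [TensorProduct.add_tmul, map_add, hs, ht]
    | tmul v w =>
      rw [tra_tmul, tra_tmul, Bialgebra.comul_mul]
      generalize (Coalgebra.comul (R := k) b) = s
      induction s with
      | zero => simp
      | add s t hs ht => simp only [TensorProduct.add_tmul, add_mul, map_add, hs, ht]
      | tmul x y =>
        rw [TensorProduct.map_tmul, tra_tmul]
        generalize (Coalgebra.comul (R := k) b') = s
        induction s with
        | zero => simp
        | add s t hs ht => simp only [mul_add, map_add, hs, ht]
        | tmul p q => simp [hrVm, hrWm]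
  · intro a x b n b1 b2 hb
    induction x with
    | zero => simp
    | add s t hs ht =>
      simp only [TensorProduct.tmul_add, TensorProduct.add_tmul, map_add, hs, ht,
        Finset.sum_add_distrib]
    | tmul v w =>
      have hPQ : auxP rV (δV v) ∘ₗ Coalgebra.comul (R := k)
          = auxQ rV δV v ∘ₗ Coalgebra.comul (R := k) := by
        ext c
        obtain ⟨m, c1, c2, hc⟩ := aux_repr (Coalgebra.comul (R := k) c)
        simp only [LinearMap.comp_apply, hc, map_sum, auxP_tmul, auxQ_tmul]
        exact hYD c v m c1 c2 hc
      let S : B →ₗ[k] (V ⊗[k] B →ₗ[k] V ⊗[k] W) := auxS rA actW rW a w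
      let Φ : (B ⊗[k] B →ₗ[k] V ⊗[k] B) → ((B ⊗[k] B) ⊗[k] B →ₗ[k] V ⊗[k] W) :=
        fun P => TensorProduct.lift (S.flip ∘ₗ P)
      have hΦ : ∀ P x z, Φ P (x ⊗ₜ z) = S z (P x) := fun P x z => rfl
      have hΦadd : ∀ P Q, Φ (P + Q) = Φ P + Φ Q := by
        intro P Q
        apply TensorProduct.ext'
        intro x z
        simp [hΦ]
      have hΦzero : Φ 0 = 0 := by
        apply TensorProduct.ext'
        intro x z
        simp [hΦ]
      have hco : ∀ P, ∑ i, Φ P ((TensorProduct.assoc k B B B).symm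
            (b1 i ⊗ₜ[k] Coalgebra.comul (R := k) (b2 i)))
          = Φ (P ∘ₗ TensorProduct.lift (TensorProduct.mk k B B)) (LinearMap.rTensor B
            (Coalgebra.comul (R := k)) (Coalgebra.comul (R := k) b)) := by
        intro P
        rw [← Coalgebra.coassoc_symm_apply, hb]
        simp only [map_sum, LinearMap.lTensor_tmul, TensorProduct.lift_mk, LinearMap.comp_id]
      have hfin : ∑ i, Φ (auxP rV (δV v)) ((TensorProduct.assoc k B B B).symm
            (b1 i ⊗ₜ[k] Coalgebra.comul (R := k) (b2 i)))
          = ∑ i, Φ (auxQ rV δV v) ((TensorProduct.assoc k B B B).symm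
            (b1 i ⊗ₜ[k] Coalgebra.comul (R := k) (b2 i))) := by
        rw [hco, hco, hb]
        simp only [map_sum, LinearMap.rTensor_tmul, TensorProduct.lift_mk, LinearMap.comp_id, hΦ]
        refine Finset.sum_congr rfl fun i _ => ?_
        exact congrArg _ (LinearMap.congr_fun hPQ (b1 i))
      have hL : ∀ t : V ⊗[k] B, tensorRightAction rV rW
          ((LinearMap.lTensor V (actW.flip w ∘ₗ rA.flip a) t) ⊗ₜ[k] b)
          = ∑ i, Φ (auxP rV t) ((TensorProduct.assoc k B B B).symm
            (b1 i ⊗ₜ[k] Coalgebra.comul (R := k) (b2 i))) := by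
        intro t
        induction t with
        | zero => simp [auxP_zero, hΦzero]
        | add s t hs ht =>
          simp only [TensorProduct.add_tmul, map_add, hs, ht, auxP_add, hΦadd,
            LinearMap.add_apply, Finset.sum_add_distrib]
        | tmul x y =>
          rw [LinearMap.lTensor_tmul, tra_tmul, hb, map_sum]
          refine Finset.sum_congr rfl fun i _ => ?_
          obtain ⟨m, c1, c2, hc⟩ := aux_repr (Coalgebra.comul (R := k) (b2 i))
          rw [TensorProduct.map_tmul, LinearMap.flip_apply, LinearMap.flip_apply,
            LinearMap.comp_apply, LinearMap.flip_apply, LinearMap.flip_apply,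
            hWcompat _ _ _ m c1 c2 hc, hc]
          simp [TensorProduct.tmul_sum, hΦ, S, auxS_apply, auxP_tmul, hrAm]
      have hR : ∀ i, inducedAAction δV rA actW
            ((rA (b1 i) a) ⊗ₜ[k] tensorRightAction rV rW ((v ⊗ₜ[k] w) ⊗ₜ[k] b2 i))
          = Φ (auxQ rV δV v) ((TensorProduct.assoc k B B B).symm
            (b1 i ⊗ₜ[k] Coalgebra.comul (R := k) (b2 i))) := by
        intro i
        rw [tra_tmul]
        generalize (Coalgebra.comul (R := k) (b2 i)) = s
        induction s with
        | zero => simp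
        | add s t hs ht => simp only [TensorProduct.tmul_add, map_add, hs, ht]
        | tmul y z =>
          rw [TensorProduct.map_tmul, ind_tmul, TensorProduct.assoc_symm_tmul, hΦ, auxQ_tmul]
          simp only [S, auxS_apply]
          rw [← LinearMap.lTensor_comp_apply]
          congr 2
          ext c
          simp [hrAm]
      rw [ind_tmul, hL, hfin]
      exact Finset.sum_congr rfl fun i _ => (hR i).symm


end
end

section
/- Let B be a bialgebra over a field k, V a left Yetter–Drinfeld module over B, and W a left Hopf module over B. Then V⊗W, equipped with the action b·(v⊗w) := (b₍₁₎·v)⊗(b₍₂₎·w) and the coaction δ(v⊗w) := v₍₋₁₎w₍₋₁₎ ⊗ v₍₀₎⊗w₍₀₎, is again a left Hopf module over B. -/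
/-!
STATEMENT 6: For a bialgebra `B`, a left Yetter–Drinfeld module `V` and a left Hopf module
`W`, the tensor product `V ⊗ W` with the tensor action `b·(v⊗w) = (b₍₁₎·v)⊗(b₍₂₎·w)` and
the tensor coaction `δ(v⊗w) = v₍₋₁₎w₍₋₁₎ ⊗ v₍₀₎⊗w₍₀₎` is again a left Hopf module over `B`.
-/

open scoped TensorProduct

noncomputable section

/-- The tensor product action `b · (v ⊗ w) = (b₍₁₎ · v) ⊗ (b₍₂₎ · w)`. -/
def tensorAction {k B V W : Type} [Field k] [Ring B] [Bialgebra k B]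
    [AddCommGroup V] [Module k V] [AddCommGroup W] [Module k W]
    (actV : B →ₗ[k] V →ₗ[k] V) (actW : B →ₗ[k] W →ₗ[k] W) :
    B ⊗[k] (V ⊗[k] W) →ₗ[k] V ⊗[k] W :=
  TensorProduct.map (TensorProduct.lift actV) (TensorProduct.lift actW)
    ∘ₗ (TensorProduct.tensorTensorTensorComm k B B V W).toLinearMap
    ∘ₗ LinearMap.rTensor (V ⊗[k] W) (Coalgebra.comul (R := k))

section helpers

variable {k B V W : Type} [Field k] [Ring B] [Bialgebra k B]
    [AddCommGroup V] [Module k V] [AddCommGroup W] [Module k W]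

/-- Every tensor is a finite sum of pure tensors indexed by `Fin n`. -/
theorem exists_fin_repr (t : B ⊗[k] B) :
    ∃ (n : ℕ) (b1 b2 : Fin n → B), t = ∑ i, b1 i ⊗ₜ[k] b2 i := by
  induction t with
  | zero => exact ⟨0, Fin.elim0, Fin.elim0, by simp⟩
  | tmul x y => exact ⟨1, fun _ => x, fun _ => y, by simp⟩
  | add s t hs ht =>
    obtain ⟨n, a, b, rfl⟩ := hs
    obtain ⟨m, c, d, rfl⟩ := ht
    exact ⟨n + m, Fin.append a c, Fin.append b d, by simp [Fin.sum_univ_add]⟩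

/-- Multiply the `B`-legs. -/
def mulLegs (k B X Y : Type) [Field k] [Ring B] [Bialgebra k B]
    [AddCommGroup X] [Module k X] [AddCommGroup Y] [Module k Y] :
    (B ⊗[k] X) ⊗[k] (B ⊗[k] Y) →ₗ[k] B ⊗[k] (X ⊗[k] Y) :=
  LinearMap.rTensor (X ⊗[k] Y) (LinearMap.mul' k B)
    ∘ₗ (TensorProduct.tensorTensorTensorComm k B X B Y).toLinearMap

@[simp] theorem mulLegs_tmul {X Y : Type}
    [AddCommGroup X] [Module k X] [AddCommGroup Y] [Module k Y] (b c : B) (x : X) (y : Y) :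
    mulLegs k B X Y ((b ⊗ₜ x) ⊗ₜ (c ⊗ₜ y)) = (b * c) ⊗ₜ (x ⊗ₜ y) := by
  simp [mulLegs]

theorem tensorCoaction_tmul (δV : V →ₗ[k] B ⊗[k] V) (δW : W →ₗ[k] B ⊗[k] W) (v : V) (w : W) :
    tensorCoaction δV δW (v ⊗ₜ w) = mulLegs k B V W (δV v ⊗ₜ δW w) := by
  simp [tensorCoaction, mulLegs]

/-- action of `B ⊗ B` on `V ⊗ W`. -/
def act2 (actV : B →ₗ[k] V →ₗ[k] V) (actW : B →ₗ[k] W →ₗ[k] W) :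
    B ⊗[k] B →ₗ[k] (V ⊗[k] W →ₗ[k] V ⊗[k] W) :=
  TensorProduct.lift ((TensorProduct.mapBilinear (.id k) V W V W).compl₁₂ actV actW)

@[simp] theorem act2_tmul (actV : B →ₗ[k] V →ₗ[k] V) (actW : B →ₗ[k] W →ₗ[k] W) (b c : B) :
    act2 actV actW (b ⊗ₜ c) = TensorProduct.map (actV b) (actW c) := by
  simp [act2]

theorem tensorAction_tmul (actV : B →ₗ[k] V →ₗ[k] V) (actW : B →ₗ[k] W →ₗ[k] W) (b : B)
    (x : V ⊗[k] W) :
    tensorAction actV actW (b ⊗ₜ x) = act2 actV actW (Coalgebra.comul (R := k) b) x := by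
  simp only [tensorAction, LinearMap.comp_apply, LinearMap.rTensor_tmul]
  generalize Coalgebra.comul (R := k) b = t
  induction t with
  | zero => simp
  | add s t hs ht => simp only [TensorProduct.add_tmul, map_add, hs, ht, LinearMap.add_apply]
  | tmul b c =>
    induction x with
    | zero => simp
    | add s t hs ht => simp only [TensorProduct.tmul_add, map_add, hs, ht]
    | tmul v w => simp

theorem act2_mul (actV : B →ₗ[k] V →ₗ[k] V) (actW : B →ₗ[k] W →ₗ[k] W)
    (hV : ∀ (b b' : B) (v : V), actV (b * b') v = actV b (actV b' v))
    (hW : ∀ (b b' : B) (w : W), actW (b * b') w = actW b (actW b' w))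
    (s t : B ⊗[k] B) (x : V ⊗[k] W) :
    act2 actV actW (s * t) x = act2 actV actW s (act2 actV actW t x) := by
  induction s with
  | zero => simp
  | add s s' hs ht => simp only [add_mul, map_add, hs, ht, LinearMap.add_apply]
  | tmul b c =>
    induction t with
    | zero => simp
    | add s s' hs ht => simp only [mul_add, map_add, hs, ht, LinearMap.add_apply]
    | tmul b' c' =>
      induction x with
      | zero => simp
      | add s t hs ht => simp only [map_add, hs, ht]
      | tmul v w => simp [hV, hW]

/-- Multiply the two pairs of `B`-legs. -/
def mulLegs2 (k B V W : Type) [Field k] [Ring B] [Bialgebra k B]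
    [AddCommGroup V] [Module k V] [AddCommGroup W] [Module k W] :
    (B ⊗[k] (B ⊗[k] V)) ⊗[k] (B ⊗[k] (B ⊗[k] W)) →ₗ[k] B ⊗[k] (B ⊗[k] (V ⊗[k] W)) :=
  LinearMap.lTensor B (mulLegs k B V W) ∘ₗ mulLegs k B (B ⊗[k] V) (B ⊗[k] W)

theorem coassoc_left (p : B ⊗[k] V) (q : B ⊗[k] W) :
    (TensorProduct.assoc k B B (V ⊗[k] W))
        ((LinearMap.rTensor (V ⊗[k] W) (Coalgebra.comul (R := k))) (mulLegs k B V W (p ⊗ₜ q)))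
      = mulLegs2 k B V W
        ((TensorProduct.assoc k B B V (LinearMap.rTensor V (Coalgebra.comul (R := k)) p)) ⊗ₜ
        (TensorProduct.assoc k B B W (LinearMap.rTensor W (Coalgebra.comul (R := k)) q))) := by
  induction p with
  | zero => simp
  | add s s' hs ht => simp only [TensorProduct.add_tmul, map_add, hs, ht]
  | tmul b v =>
    induction q with
    | zero => simp
    | add s s' hs ht => simp only [TensorProduct.tmul_add, map_add, hs, ht]
    | tmul c w =>
      simp only [mulLegs_tmul, LinearMap.rTensor_tmul, Bialgebra.comul_mul]
      generalize Coalgebra.comul (R := k) b = s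
      generalize Coalgebra.comul (R := k) c = t
      induction s with
      | zero => simp
      | add s s' hs ht => simp only [TensorProduct.add_tmul, add_mul, map_add, hs, ht]
      | tmul b b' =>
        induction t with
        | zero => simp
        | add s s' hs ht =>
          simp only [TensorProduct.add_tmul, TensorProduct.tmul_add, mul_add, map_add, hs, ht]
        | tmul c c' => simp [mulLegs2]

theorem coassoc_right (δV : V →ₗ[k] B ⊗[k] V) (δW : W →ₗ[k] B ⊗[k] W)
    (p : B ⊗[k] V) (q : B ⊗[k] W) :
    LinearMap.lTensor B (tensorCoaction δV δW) (mulLegs k B V W (p ⊗ₜ q))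
      = mulLegs2 k B V W (LinearMap.lTensor B δV p ⊗ₜ LinearMap.lTensor B δW q) := by
  induction p with
  | zero => simp
  | add s s' hs ht => simp only [TensorProduct.add_tmul, map_add, hs, ht]
  | tmul b v =>
    induction q with
    | zero => simp
    | add s s' hs ht => simp only [TensorProduct.tmul_add, map_add, hs, ht]
    | tmul c w => simp [mulLegs2, tensorCoaction_tmul]

theorem counit_mulLegs (p : B ⊗[k] V) (q : B ⊗[k] W) :
    (TensorProduct.lid k (V ⊗[k] W))
        ((LinearMap.rTensor (V ⊗[k] W) (Coalgebra.counit (R := k))) (mulLegs k B V W (p ⊗ₜ q)))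
      = (TensorProduct.lid k V (LinearMap.rTensor V (Coalgebra.counit (R := k)) p)) ⊗ₜ
        (TensorProduct.lid k W (LinearMap.rTensor W (Coalgebra.counit (R := k)) q)) := by
  induction p with
  | zero => simp
  | add s s' hs ht => simp only [TensorProduct.add_tmul, map_add, hs, ht]
  | tmul b v =>
    induction q with
    | zero => simp
    | add s s' hs ht => simp only [TensorProduct.tmul_add, map_add, hs, ht]
    | tmul c w => simp [← TensorProduct.smul_tmul', smul_smul, mul_comm]

/-- `b ⊗ c ↦ b v₍₋₁₎ ⊗ c v₍₀₎` for `p = v₍₋₁₎ ⊗ v₍₀₎`. -/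
def ydL (actV : B →ₗ[k] V →ₗ[k] V) (p : B ⊗[k] V) : B ⊗[k] B →ₗ[k] B ⊗[k] V :=
  (TensorProduct.lift
    ((TensorProduct.mapBilinear (.id k) B V B V).compl₁₂ (LinearMap.mul k B) actV)).flip p

theorem ydL_tmul (actV : B →ₗ[k] V →ₗ[k] V) (p : B ⊗[k] V) (b c : B) :
    ydL actV p (b ⊗ₜ c) = TensorProduct.map (LinearMap.mulLeft k b) (actV c) p := by
  simp [ydL]; rfl

/-- `b ⊗ c ↦ (b v)₍₋₁₎ c ⊗ (b v)₍₀₎`. -/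
def ydR (actV : B →ₗ[k] V →ₗ[k] V) (δV : V →ₗ[k] B ⊗[k] V) (v : V) :
    B ⊗[k] B →ₗ[k] B ⊗[k] V :=
  TensorProduct.lift
    ((LinearMap.rTensorHom V ∘ₗ (LinearMap.mul k B).flip).flip ∘ₗ δV ∘ₗ actV.flip v)

theorem ydR_tmul (actV : B →ₗ[k] V →ₗ[k] V) (δV : V →ₗ[k] B ⊗[k] V) (v : V) (b c : B) :
    ydR actV δV v (b ⊗ₜ c) = LinearMap.rTensor V (LinearMap.mulRight k c) (δV (actV b v)) := by
  simp [ydR]; rfl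

/-- `d ↦ w₍₋₁₎ ⊗ d w₍₀₎`. -/
def actLeg (actW : B →ₗ[k] W →ₗ[k] W) (q : B ⊗[k] W) : B →ₗ[k] B ⊗[k] W :=
  (LinearMap.lTensorHom B ∘ₗ actW).flip q

theorem actLeg_apply (actW : B →ₗ[k] W →ₗ[k] W) (q : B ⊗[k] W) (d : B) :
    actLeg actW q d = LinearMap.lTensor B (actW d) q := by
  simp [actLeg]

theorem shift_leg (actW : B →ₗ[k] W →ₗ[k] W) (c d : B) (p : B ⊗[k] V) (q : B ⊗[k] W) :
    mulLegs k B V W (p ⊗ₜ TensorProduct.map (LinearMap.mulLeft k c) (actW d) q)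
      = mulLegs k B V W (LinearMap.rTensor V (LinearMap.mulRight k c) p ⊗ₜ
          LinearMap.lTensor B (actW d) q) := by
  induction p with
  | zero => simp
  | add s s' hs ht => simp only [TensorProduct.add_tmul, map_add, hs, ht]
  | tmul b v =>
    induction q with
    | zero => simp
    | add s s' hs ht => simp only [TensorProduct.tmul_add, map_add, hs, ht]
    | tmul c w => simp [mul_assoc]

theorem map_mulLegs (actV : B →ₗ[k] V →ₗ[k] V) (actW : B →ₗ[k] W →ₗ[k] W) (b c d : B)
    (p : B ⊗[k] V) (q : B ⊗[k] W) :
    TensorProduct.map (LinearMap.mulLeft k b) (TensorProduct.map (actV c) (actW d))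
        (mulLegs k B V W (p ⊗ₜ q))
      = mulLegs k B V W (TensorProduct.map (LinearMap.mulLeft k b) (actV c) p ⊗ₜ
          LinearMap.lTensor B (actW d) q) := by
  induction p with
  | zero => simp
  | add s s' hs ht => simp only [TensorProduct.add_tmul, map_add, hs, ht]
  | tmul b v =>
    induction q with
    | zero => simp
    | add s s' hs ht => simp only [TensorProduct.tmul_add, map_add, hs, ht]
    | tmul c w => simp [mul_assoc]

theorem hopf_compat (actV : B →ₗ[k] V →ₗ[k] V) (δV : V →ₗ[k] B ⊗[k] V)
    (actW : B →ₗ[k] W →ₗ[k] W) (δW : W →ₗ[k] B ⊗[k] W) (v : V) (w : W)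
    (hYD : ∀ b : B, ydL actV (δV v) (Coalgebra.comul (R := k) b)
      = ydR actV δV v (Coalgebra.comul (R := k) b))
    (hW : ∀ b : B, δW (actW b w) = ydL actW (δW w) (Coalgebra.comul (R := k) b))
    (b : B) (n : ℕ) (b1 b2 : Fin n → B)
    (hb : Coalgebra.comul (R := k) b = ∑ i, b1 i ⊗ₜ[k] b2 i) :
    tensorCoaction δV δW (tensorAction actV actW (b ⊗ₜ[k] (v ⊗ₜ w)))
        = ∑ i, TensorProduct.map (LinearMap.mulLeft k (b1 i))
            (tensorAction actV actW ∘ₗ TensorProduct.mk k B (V ⊗[k] W) (b2 i))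
            (tensorCoaction δV δW (v ⊗ₜ w)) := by
  -- the two big maps `(B ⊗ B) ⊗ B → B ⊗ (V ⊗ W)`
  let P : (B ⊗[k] B →ₗ[k] B ⊗[k] V) → ((B ⊗[k] B) ⊗[k] B →ₗ[k] B ⊗[k] (V ⊗[k] W)) :=
    fun Y => mulLegs k B V W ∘ₗ TensorProduct.map Y (actLeg actW (δW w))
  have hL : ∀ t : B ⊗[k] B, tensorCoaction δV δW (act2 actV actW t (v ⊗ₜ w))
      = P (ydR actV δV v) ((TensorProduct.assoc k B B B).symm
          (LinearMap.lTensor B (Coalgebra.comul (R := k)) t)) := by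
    intro t
    induction t with
    | zero => simp
    | add s s' hs ht => simp only [map_add, hs, ht, LinearMap.add_apply]
    | tmul b c =>
      simp only [act2_tmul, TensorProduct.map_tmul, tensorCoaction_tmul, hW,
        LinearMap.lTensor_tmul]
      generalize Coalgebra.comul (R := k) c = t
      induction t with
      | zero => simp
      | add s s' hs ht => simp only [TensorProduct.tmul_add, map_add, hs, ht]
      | tmul c d => simp [P, ydL_tmul, ydR_tmul, actLeg_apply, shift_leg]
  have hM : ∀ t : B ⊗[k] B,
      P (ydR actV δV v) (LinearMap.rTensor B (Coalgebra.comul (R := k)) t)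
        = P (ydL actV (δV v)) (LinearMap.rTensor B (Coalgebra.comul (R := k)) t) := by
    intro t
    induction t with
    | zero => simp
    | add s s' hs ht => simp only [map_add, hs, ht]
    | tmul b c => simp [P, hYD]
  have hR : ∀ c d : B, TensorProduct.map (LinearMap.mulLeft k c)
            (tensorAction actV actW ∘ₗ TensorProduct.mk k B (V ⊗[k] W) d)
            (tensorCoaction δV δW (v ⊗ₜ w))
      = P (ydL actV (δV v)) ((TensorProduct.assoc k B B B).symm
          (LinearMap.lTensor B (Coalgebra.comul (R := k)) (c ⊗ₜ d))) := by
    intro c d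
    have : tensorAction actV actW ∘ₗ TensorProduct.mk k B (V ⊗[k] W) d
        = act2 actV actW (Coalgebra.comul (R := k) d) := by
      refine LinearMap.ext fun x => ?_
      exact tensorAction_tmul actV actW d x
    rw [this, LinearMap.lTensor_tmul, tensorCoaction_tmul]
    generalize Coalgebra.comul (R := k) d = t
    induction t with
    | zero => simp
    | add s s' hs ht =>
      simp only [TensorProduct.tmul_add, TensorProduct.map_add_right, LinearMap.add_apply,
        map_add, hs, ht]
    | tmul e f => simp [P, ydL_tmul, actLeg_apply, map_mulLegs]
  rw [tensorAction_tmul, hL, Coalgebra.coassoc_symm_apply, hM, ← Coalgebra.coassoc_symm_apply, hb]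
  simp only [map_sum, hR]

end helpers

theorem tensor_of_yd_and_hopf_module_is_hopf_module
    {k B V W : Type} [Field k] [Ring B] [Bialgebra k B]
    [AddCommGroup V] [Module k V] [AddCommGroup W] [Module k W]
    -- `V` is a left Yetter–Drinfeld module over `B`
    (actV : B →ₗ[k] V →ₗ[k] V)
    (hactV1 : ∀ v : V, actV 1 v = v)
    (hactVm : ∀ (b b' : B) (v : V), actV (b * b') v = actV b (actV b' v))
    (δV : V →ₗ[k] B ⊗[k] V)
    (hδV1 : ∀ v : V, (TensorProduct.assoc k B B V)
        ((LinearMap.rTensor V (Coalgebra.comul (R := k))) (δV v))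
        = (LinearMap.lTensor B δV) (δV v))
    (hδV2 : ∀ v : V, (TensorProduct.lid k V)
        ((LinearMap.rTensor V (Coalgebra.counit (R := k))) (δV v)) = v)
    (hYD : ∀ (b : B) (v : V) (n : ℕ) (b1 b2 : Fin n → B),
      Coalgebra.comul (R := k) b = ∑ i, b1 i ⊗ₜ[k] b2 i →
      ∑ i, TensorProduct.map (LinearMap.mulLeft k (b1 i)) (actV (b2 i)) (δV v)
        = ∑ i, LinearMap.rTensor V (LinearMap.mulRight k (b2 i)) (δV (actV (b1 i) v)))
    -- `W` is a left Hopf module over `B`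
    (actW : B →ₗ[k] W →ₗ[k] W)
    (hactW1 : ∀ w : W, actW 1 w = w)
    (hactWm : ∀ (b b' : B) (w : W), actW (b * b') w = actW b (actW b' w))
    (δW : W →ₗ[k] B ⊗[k] W)
    (hδW1 : ∀ w : W, (TensorProduct.assoc k B B W)
        ((LinearMap.rTensor W (Coalgebra.comul (R := k))) (δW w))
        = (LinearMap.lTensor B δW) (δW w))
    (hδW2 : ∀ w : W, (TensorProduct.lid k W)
        ((LinearMap.rTensor W (Coalgebra.counit (R := k))) (δW w)) = w)
    (hHopfW : ∀ (b : B) (w : W) (n : ℕ) (b1 b2 : Fin n → B),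
      Coalgebra.comul (R := k) b = ∑ i, b1 i ⊗ₜ[k] b2 i →
      δW (actW b w) = ∑ i, TensorProduct.map (LinearMap.mulLeft k (b1 i)) (actW (b2 i)) (δW w)) :
    -- `V ⊗ W` is a left `B`-module
    (∀ x : V ⊗[k] W, tensorAction actV actW ((1 : B) ⊗ₜ[k] x) = x) ∧
    (∀ (b b' : B) (x : V ⊗[k] W),
      tensorAction actV actW ((b * b') ⊗ₜ[k] x)
        = tensorAction actV actW (b ⊗ₜ[k] tensorAction actV actW (b' ⊗ₜ[k] x))) ∧
    -- `V ⊗ W` is a left `B`-comodule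
    (∀ x : V ⊗[k] W, (TensorProduct.assoc k B B (V ⊗[k] W))
        ((LinearMap.rTensor (V ⊗[k] W) (Coalgebra.comul (R := k))) (tensorCoaction δV δW x))
        = (LinearMap.lTensor B (tensorCoaction δV δW)) (tensorCoaction δV δW x)) ∧
    (∀ x : V ⊗[k] W, (TensorProduct.lid k (V ⊗[k] W))
        ((LinearMap.rTensor (V ⊗[k] W) (Coalgebra.counit (R := k))) (tensorCoaction δV δW x))
        = x) ∧
    -- the Hopf module compatibility `δ(b·x) = b₍₁₎x₍₋₁₎ ⊗ b₍₂₎·x₍₀₎`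
    (∀ (b : B) (x : V ⊗[k] W) (n : ℕ) (b1 b2 : Fin n → B),
      Coalgebra.comul (R := k) b = ∑ i, b1 i ⊗ₜ[k] b2 i →
      tensorCoaction δV δW (tensorAction actV actW (b ⊗ₜ[k] x))
        = ∑ i, TensorProduct.map (LinearMap.mulLeft k (b1 i))
            (tensorAction actV actW ∘ₗ TensorProduct.mk k B (V ⊗[k] W) (b2 i))
            (tensorCoaction δV δW x)) := by
  have hYD' : ∀ (b : B) (v : V), ydL actV (δV v) (Coalgebra.comul (R := k) b)
      = ydR actV δV v (Coalgebra.comul (R := k) b) := by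
    intro b v
    obtain ⟨n, b1, b2, h⟩ := exists_fin_repr (Coalgebra.comul (R := k) b)
    rw [h]
    simpa only [map_sum, ydL_tmul, ydR_tmul] using hYD b v n b1 b2 h
  have hW' : ∀ (b : B) (w : W),
      δW (actW b w) = ydL actW (δW w) (Coalgebra.comul (R := k) b) := by
    intro b w
    obtain ⟨n, b1, b2, h⟩ := exists_fin_repr (Coalgebra.comul (R := k) b)
    rw [h]
    simpa only [map_sum, ydL_tmul] using hHopfW b w n b1 b2 h
  refine ⟨fun x => ?_, fun b b' x => ?_, fun x => ?_, fun x => ?_, fun b x n b1 b2 hb => ?_⟩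
  · rw [tensorAction_tmul, Bialgebra.comul_one, Algebra.TensorProduct.one_def, act2_tmul]
    have h1 : actV 1 = LinearMap.id := LinearMap.ext hactV1
    have h2 : actW 1 = LinearMap.id := LinearMap.ext hactW1
    simp [h1, h2]
  · simp only [tensorAction_tmul, Bialgebra.comul_mul]
    exact act2_mul actV actW hactVm hactWm _ _ x
  · induction x with
    | zero => simp
    | add s t hs ht => simp only [map_add, hs, ht]
    | tmul v w => rw [tensorCoaction_tmul, coassoc_left, coassoc_right, hδV1, hδW1]
  · induction x with
    | zero => simp
    | add s t hs ht => simp only [map_add, hs, ht]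
    | tmul v w => rw [tensorCoaction_tmul, counit_mulLegs, hδV2, hδW2]
  · induction x with
    | zero => simp
    | add s t hs ht =>
      simp only [TensorProduct.tmul_add, map_add, hs, ht, Finset.sum_add_distrib]
    | tmul v w =>
      exact hopf_compat actV δV actW δW v w (hYD' · v) (hW' · w) b n b1 b2 hb


end
end

section
/- Let B be a bialgebra over a field k and σ: B⊗B→k a convolution-invertible linear map. Define the right twisted product g·_σ h := g₍₁₎h₍₁₎ σ(g₍₂₎⊗h₍₂₎). Then (B, ·_σ, 1) is an associative unital k-algebra if and only if σ satisfies the right 2-cocycle identity σ(h⊗k₍₁₎l₍₁₎)σ(k₍₂₎⊗l₍₂₎) = σ(h₍₁₎k₍₁₎⊗l)σ(h₍₂₎⊗k₍₂₎) together with σ(h⊗1)=σ(1⊗h)=ε(h). Moreover, when these hold, Δ(g·_σ h) = g₍₁₎h₍₁₎ ⊗ (g₍₂₎·_σ h₍₂₎), so the coproduct Δ: B_σ → B⊗B_σ makes the twisted algebra B_σ a left B-comodule algebra. -/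
/-!
STATEMENT 11: For a convolution-invertible `σ : B ⊗ B → k`, the right twisted product
`g ·σ h := g₍₁₎h₍₁₎ σ(g₍₂₎ ⊗ h₍₂₎)` is associative and unital with unit `1` iff `σ` is a
right 2-cocycle; and in this case `Δ(g ·σ h) = g₍₁₎h₍₁₎ ⊗ (g₍₂₎ ·σ h₍₂₎)`, making the
twisted algebra `B_σ` a left `B`-comodule algebra.
-/

open scoped TensorProduct

section Helpers

variable {k B : Type} [Field k] [Ring B] [Bialgebra k B]

/-- The map sending (a ⊗ b) ⊗ (c ⊗ d) to σ(b ⊗ d) • (a c). -/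
noncomputable def twT (σ : B ⊗[k] B →ₗ[k] k) : (B ⊗[k] B) ⊗[k] (B ⊗[k] B) →ₗ[k] B :=
  (TensorProduct.rid k B).toLinearMap ∘ₗ TensorProduct.map (LinearMap.mul' k B) σ ∘ₗ
    (TensorProduct.tensorTensorTensorComm k B B B B).toLinearMap

lemma twT_tmul (σ : B ⊗[k] B →ₗ[k] k) (a b c d : B) :
    twT σ ((a ⊗ₜ b) ⊗ₜ (c ⊗ₜ d)) = σ (b ⊗ₜ d) • (a * c) := by
  simp [twT]

/-- The map sending (a ⊗ u) ⊗ (c ⊗ v) to (a c) ⊗ twT (u ⊗ v). -/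
noncomputable def twPhi (σ : B ⊗[k] B →ₗ[k] k) :
    (B ⊗[k] (B ⊗[k] B)) ⊗[k] (B ⊗[k] (B ⊗[k] B)) →ₗ[k] B ⊗[k] B :=
  TensorProduct.map (LinearMap.mul' k B) (twT σ) ∘ₗ
    (TensorProduct.tensorTensorTensorComm k B (B ⊗[k] B) B (B ⊗[k] B)).toLinearMap

lemma twPhi_tmul (σ : B ⊗[k] B →ₗ[k] k) (a c : B) (u v : B ⊗[k] B) :
    twPhi σ ((a ⊗ₜ u) ⊗ₜ (c ⊗ₜ v)) = (a * c) ⊗ₜ twT σ (u ⊗ₜ v) := by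
  simp [twPhi]

lemma twPhi_assoc (σ : B ⊗[k] B →ₗ[k] k) (c d : B) (u v : B ⊗[k] B) :
    twPhi σ (TensorProduct.assoc k B B B (u ⊗ₜ c) ⊗ₜ TensorProduct.assoc k B B B (v ⊗ₜ d))
      = σ (c ⊗ₜ d) • (u * v) := by
  induction u with
  | zero => simp
  | add x y hx hy => simp only [TensorProduct.add_tmul, map_add, hx, hy, add_mul, smul_add]
  | tmul a b =>
    induction v with
    | zero => simp
    | add x y hx hy =>
      simp only [TensorProduct.add_tmul, TensorProduct.tmul_add, map_add, hx, hy, mul_add,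
        smul_add]
    | tmul e f =>
      simp [twPhi_tmul, twT_tmul]

lemma tw_rep (a : B) : ∃ (n : ℕ) (a1 a2 : Fin n → B),
    Coalgebra.comul (R := k) a = ∑ i, a1 i ⊗ₜ[k] a2 i := by
  obtain ⟨n, s, t, h⟩ := TensorProduct.exists_sum_tmul_eq (Coalgebra.comul (R := k) a)
  exact ⟨n, _, _, h⟩

end Helpers

theorem twisted_product_assoc_iff_two_cocycle
    {k B : Type} [Field k] [Ring B] [Bialgebra k B]
    (σ : B ⊗[k] B →ₗ[k] k)
    -- `σ` is convolution invertible
    (σinv : B ⊗[k] B →ₗ[k] k)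
    (hconv : ∀ (a b : B) (n m : ℕ) (a1 a2 : Fin n → B) (b1 b2 : Fin m → B),
      Coalgebra.comul (R := k) a = ∑ i, a1 i ⊗ₜ[k] a2 i →
      Coalgebra.comul (R := k) b = ∑ j, b1 j ⊗ₜ[k] b2 j →
      (∑ i, ∑ j, σ (a1 i ⊗ₜ[k] b1 j) * σinv (a2 i ⊗ₜ[k] b2 j)
          = Coalgebra.counit (R := k) a * Coalgebra.counit (R := k) b) ∧
      (∑ i, ∑ j, σinv (a1 i ⊗ₜ[k] b1 j) * σ (a2 i ⊗ₜ[k] b2 j)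
          = Coalgebra.counit (R := k) a * Coalgebra.counit (R := k) b))
    -- `mσ` is the right twisted product `g ·σ h = g₍₁₎h₍₁₎ σ(g₍₂₎ ⊗ h₍₂₎)`
    (mσ : B ⊗[k] B →ₗ[k] B)
    (hmσ : ∀ (g h : B) (n m : ℕ) (g1 g2 : Fin n → B) (h1 h2 : Fin m → B),
      Coalgebra.comul (R := k) g = ∑ i, g1 i ⊗ₜ[k] g2 i →
      Coalgebra.comul (R := k) h = ∑ j, h1 j ⊗ₜ[k] h2 j →
      mσ (g ⊗ₜ[k] h) = ∑ i, ∑ j, σ (g2 i ⊗ₜ[k] h2 j) • (g1 i * h1 j)) :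
    -- `(B, ·σ, 1)` is an associative unital algebra iff `σ` is a right 2-cocycle
    (((∀ x y z : B, mσ (mσ (x ⊗ₜ[k] y) ⊗ₜ[k] z) = mσ (x ⊗ₜ[k] mσ (y ⊗ₜ[k] z))) ∧
      (∀ x : B, mσ ((1 : B) ⊗ₜ[k] x) = x) ∧ (∀ x : B, mσ (x ⊗ₜ[k] (1 : B)) = x))
      ↔
     ((∀ (h g l : B) (m p : ℕ) (g1 g2 : Fin m → B) (l1 l2 : Fin p → B),
        Coalgebra.comul (R := k) g = ∑ j, g1 j ⊗ₜ[k] g2 j →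
        Coalgebra.comul (R := k) l = ∑ s, l1 s ⊗ₜ[k] l2 s →
        ∀ (n : ℕ) (h1 h2 : Fin n → B),
        Coalgebra.comul (R := k) h = ∑ i, h1 i ⊗ₜ[k] h2 i →
        ∑ j, ∑ s, σ (h ⊗ₜ[k] (g1 j * l1 s)) * σ (g2 j ⊗ₜ[k] l2 s)
          = ∑ i, ∑ j, σ ((h1 i * g1 j) ⊗ₜ[k] l) * σ (h2 i ⊗ₜ[k] g2 j)) ∧
      (∀ h : B, σ (h ⊗ₜ[k] (1 : B)) = Coalgebra.counit (R := k) h) ∧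
      (∀ h : B, σ ((1 : B) ⊗ₜ[k] h) = Coalgebra.counit (R := k) h)))
    ∧
    -- when these hold, `Δ(g ·σ h) = g₍₁₎h₍₁₎ ⊗ (g₍₂₎ ·σ h₍₂₎)`,
    -- i.e. `Δ : B_σ → B ⊗ B_σ` makes `B_σ` a left `B`-comodule algebra
    (((∀ (h g l : B) (m p : ℕ) (g1 g2 : Fin m → B) (l1 l2 : Fin p → B),
        Coalgebra.comul (R := k) g = ∑ j, g1 j ⊗ₜ[k] g2 j →
        Coalgebra.comul (R := k) l = ∑ s, l1 s ⊗ₜ[k] l2 s →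
        ∀ (n : ℕ) (h1 h2 : Fin n → B),
        Coalgebra.comul (R := k) h = ∑ i, h1 i ⊗ₜ[k] h2 i →
        ∑ j, ∑ s, σ (h ⊗ₜ[k] (g1 j * l1 s)) * σ (g2 j ⊗ₜ[k] l2 s)
          = ∑ i, ∑ j, σ ((h1 i * g1 j) ⊗ₜ[k] l) * σ (h2 i ⊗ₜ[k] g2 j)) ∧
      (∀ h : B, σ (h ⊗ₜ[k] (1 : B)) = Coalgebra.counit (R := k) h) ∧
      (∀ h : B, σ ((1 : B) ⊗ₜ[k] h) = Coalgebra.counit (R := k) h)) →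
      ∀ (g h : B) (n m : ℕ) (g1 g2 : Fin n → B) (h1 h2 : Fin m → B),
        Coalgebra.comul (R := k) g = ∑ i, g1 i ⊗ₜ[k] g2 i →
        Coalgebra.comul (R := k) h = ∑ j, h1 j ⊗ₜ[k] h2 j →
        Coalgebra.comul (R := k) (mσ (g ⊗ₜ[k] h))
          = ∑ i, ∑ j, (g1 i * h1 j) ⊗ₜ[k] mσ (g2 i ⊗ₜ[k] h2 j)) := by
  have hT : ∀ g h : B, mσ (g ⊗ₜ[k] h) =
      twT σ (Coalgebra.comul (R := k) g ⊗ₜ Coalgebra.comul (R := k) h) := by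
    intro g h
    obtain ⟨n, g1, g2, hg⟩ := tw_rep (k := k) g
    obtain ⟨m, h1, h2, hh⟩ := tw_rep (k := k) h
    rw [hmσ g h n m g1 g2 h1 h2 hg hh, hg, hh]
    simp only [TensorProduct.sum_tmul, TensorProduct.tmul_sum, map_sum, twT_tmul]
    rw [Finset.sum_comm]
  have hε : ∀ g h : B, Coalgebra.counit (R := k) (mσ (g ⊗ₜ[k] h)) = σ (g ⊗ₜ[k] h) := by
    intro g h
    obtain ⟨n, g1, g2, hg⟩ := tw_rep (k := k) g
    obtain ⟨m, h1, h2, hh⟩ := tw_rep (k := k) h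
    rw [hmσ g h n m g1 g2 h1 h2 hg hh]
    have eg : ∑ i, Coalgebra.counit (R := k) (g1 i) • g2 i = g := by
      have := Coalgebra.rTensor_counit_comul (R := k) g
      rw [hg] at this
      simpa using congrArg (TensorProduct.lid k B) this
    have eh : ∑ i, Coalgebra.counit (R := k) (h1 i) • h2 i = h := by
      have := Coalgebra.rTensor_counit_comul (R := k) h
      rw [hh] at this
      simpa using congrArg (TensorProduct.lid k B) this
    conv_rhs => rw [← eg, ← eh]
    simp only [TensorProduct.sum_tmul, TensorProduct.tmul_sum, map_sum, map_smul,
      TensorProduct.tmul_smul, ← TensorProduct.smul_tmul', Bialgebra.counit_mul, smul_eq_mul,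
      Finset.mul_sum]
    first
    | (refine Finset.sum_congr rfl fun i _ => Finset.sum_congr rfl fun j _ => ?_
       ring)
    | (rw [Finset.sum_comm]
       refine Finset.sum_congr rfl fun i _ => Finset.sum_congr rfl fun j _ => ?_
       ring)
  have hΔ : ∀ (g h : B) (n m : ℕ) (g1 g2 : Fin n → B) (h1 h2 : Fin m → B),
        Coalgebra.comul (R := k) g = ∑ i, g1 i ⊗ₜ[k] g2 i →
        Coalgebra.comul (R := k) h = ∑ j, h1 j ⊗ₜ[k] h2 j →
        Coalgebra.comul (R := k) (mσ (g ⊗ₜ[k] h))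
          = ∑ i, ∑ j, (g1 i * h1 j) ⊗ₜ[k] mσ (g2 i ⊗ₜ[k] h2 j) := by
    intro g h n m g1 g2 h1 h2 hg hh
    have cg := Coalgebra.coassoc_apply (R := k) g
    have ch := Coalgebra.coassoc_apply (R := k) h
    rw [hg] at cg
    rw [hh] at ch
    simp only [map_sum, LinearMap.rTensor_tmul, LinearMap.lTensor_tmul] at cg ch
    have key := congrArg (twPhi σ) (congrArg₂ (fun x y => x ⊗ₜ[k] y) cg ch)
    simp only [TensorProduct.sum_tmul, TensorProduct.tmul_sum, map_sum, twPhi_assoc,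
      twPhi_tmul, ← hT] at key
    rw [hmσ g h n m g1 g2 h1 h2 hg hh]
    simp only [map_sum, map_smul, Bialgebra.comul_mul]
    rw [Finset.sum_comm, key, Finset.sum_comm]
  -- the cocycle identity in closed form
  have hL : ∀ (x y z : B) (n m p : ℕ) (x1 x2 : Fin n → B) (y1 y2 : Fin m → B)
      (z1 z2 : Fin p → B), Coalgebra.comul (R := k) x = ∑ i, x1 i ⊗ₜ[k] x2 i →
      Coalgebra.comul (R := k) y = ∑ i, y1 i ⊗ₜ[k] y2 i →
      Coalgebra.comul (R := k) z = ∑ i, z1 i ⊗ₜ[k] z2 i →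
      mσ (mσ (x ⊗ₜ[k] y) ⊗ₜ[k] z) = ∑ i, ∑ j, ∑ l,
        σ (mσ (x2 i ⊗ₜ[k] y2 j) ⊗ₜ[k] z2 l) • (x1 i * y1 j * z1 l) := by
    intro x y z n m p x1 x2 y1 y2 z1 z2 hx hy hz
    rw [hT, hΔ x y n m x1 x2 y1 y2 hx hy, hz]
    simp only [TensorProduct.sum_tmul, map_sum, twT_tmul]
    simp only [TensorProduct.tmul_sum, map_sum, twT_tmul]
  have hR : ∀ (x y z : B) (n m p : ℕ) (x1 x2 : Fin n → B) (y1 y2 : Fin m → B)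
      (z1 z2 : Fin p → B), Coalgebra.comul (R := k) x = ∑ i, x1 i ⊗ₜ[k] x2 i →
      Coalgebra.comul (R := k) y = ∑ i, y1 i ⊗ₜ[k] y2 i →
      Coalgebra.comul (R := k) z = ∑ i, z1 i ⊗ₜ[k] z2 i →
      mσ (x ⊗ₜ[k] mσ (y ⊗ₜ[k] z)) = ∑ i, ∑ j, ∑ l,
        σ (x2 i ⊗ₜ[k] mσ (y2 j ⊗ₜ[k] z2 l)) • (x1 i * y1 j * z1 l) := by
    intro x y z n m p x1 x2 y1 y2 z1 z2 hx hy hz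
    rw [hT, hΔ y z m p y1 y2 z1 z2 hy hz, hx, TensorProduct.sum_tmul, map_sum]
    refine Finset.sum_congr rfl fun i _ => ?_
    simp only [TensorProduct.tmul_sum, map_sum, twT_tmul, mul_assoc]
  have hC1 : ∀ (h g l : B) (m p : ℕ) (g1 g2 : Fin m → B) (l1 l2 : Fin p → B),
        Coalgebra.comul (R := k) g = ∑ j, g1 j ⊗ₜ[k] g2 j →
        Coalgebra.comul (R := k) l = ∑ s, l1 s ⊗ₜ[k] l2 s →
        ∑ j, ∑ s, σ (h ⊗ₜ[k] (g1 j * l1 s)) * σ (g2 j ⊗ₜ[k] l2 s)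
          = σ (h ⊗ₜ[k] mσ (g ⊗ₜ[k] l)) := by
    intro h g l m p g1 g2 l1 l2 hg hl
    rw [hmσ g l m p g1 g2 l1 l2 hg hl]
    simp only [TensorProduct.tmul_sum, map_sum, TensorProduct.tmul_smul, map_smul, smul_eq_mul,
      mul_comm]
  have hC2 : ∀ (h g l : B) (n m : ℕ) (h1 h2 : Fin n → B) (g1 g2 : Fin m → B),
        Coalgebra.comul (R := k) h = ∑ i, h1 i ⊗ₜ[k] h2 i →
        Coalgebra.comul (R := k) g = ∑ j, g1 j ⊗ₜ[k] g2 j →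
        ∑ i, ∑ j, σ ((h1 i * g1 j) ⊗ₜ[k] l) * σ (h2 i ⊗ₜ[k] g2 j)
          = σ (mσ (h ⊗ₜ[k] g) ⊗ₜ[k] l) := by
    intro h g l n m h1 h2 g1 g2 hh hg
    rw [hmσ h g n m h1 h2 g1 g2 hh hg]
    simp only [TensorProduct.sum_tmul, map_sum, ← TensorProduct.smul_tmul', map_smul,
      smul_eq_mul, mul_comm]
  have h11 : Coalgebra.comul (R := k) (1 : B)
      = ∑ _i : Fin 1, (1 : B) ⊗ₜ[k] (1 : B) := by
    simp [Algebra.TensorProduct.one_def]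
  refine ⟨⟨?_, ?_⟩, fun _ => hΔ⟩
  · rintro ⟨has, h1, h2⟩
    refine ⟨?_, ?_, ?_⟩
    · intro h g l m p g1 g2 l1 l2 hg hl n h1 h2 hh
      rw [hC1 h g l m p g1 g2 l1 l2 hg hl, hC2 h g l n m h1 h2 g1 g2 hh hg, ← hε, ← hε, has]
    · intro h
      rw [← hε, h2]
    · intro h
      rw [← hε, h1]
  · rintro ⟨hco, h1, h2⟩
    refine ⟨?_, ?_, ?_⟩
    · intro x y z
      obtain ⟨n, x1, x2, hx⟩ := tw_rep (k := k) x
      obtain ⟨m, y1, y2, hy⟩ := tw_rep (k := k) y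
      obtain ⟨p, z1, z2, hz⟩ := tw_rep (k := k) z
      rw [hL x y z n m p x1 x2 y1 y2 z1 z2 hx hy hz, hR x y z n m p x1 x2 y1 y2 z1 z2 hx hy hz]
      have hcl : ∀ h g l : B, σ (mσ (h ⊗ₜ[k] g) ⊗ₜ[k] l) = σ (h ⊗ₜ[k] mσ (g ⊗ₜ[k] l)) := by
        intro h g l
        obtain ⟨n, x1, x2, hx⟩ := tw_rep (k := k) h
        obtain ⟨m, y1, y2, hy⟩ := tw_rep (k := k) g
        obtain ⟨p, z1, z2, hz⟩ := tw_rep (k := k) l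
        rw [← hC1 h g l m p y1 y2 z1 z2 hy hz, ← hC2 h g l n m x1 x2 y1 y2 hx hy]
        exact (hco h g l m p y1 y2 z1 z2 hy hz n x1 x2 hx).symm
      simp only [hcl]
    · intro x
      obtain ⟨n, x1, x2, hx⟩ := tw_rep (k := k) x
      rw [hmσ 1 x 1 n _ _ x1 x2 h11 hx]
      have := Coalgebra.lTensor_counit_comul (R := k) x
      rw [hx] at this
      simpa [h2] using congrArg (TensorProduct.rid k B) this
    · intro x
      obtain ⟨n, x1, x2, hx⟩ := tw_rep (k := k) x
      rw [hmσ x 1 n 1 x1 x2 _ _ hx h11]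
      have := Coalgebra.lTensor_counit_comul (R := k) x
      rw [hx] at this
      simpa [h1] using congrArg (TensorProduct.rid k B) this
end

section
/- Let B be a bialgebra over a field k, σ a right 2-cocycle on B, and β: B→k a convolution-invertible linear map with β(1)=1, whose convolution inverse is β⁻*. Then σ^β defined by σ^β(h⊗k) := β⁻*(h₍₁₎k₍₁₎) σ(h₍₂₎⊗k₍₂₎) β(h₍₃₎) β(k₍₃₎) is again a right 2-cocycle on B: it is convolution invertible, satisfies σ^β(h⊗k₍₁₎l₍₁₎)σ^β(k₍₂₎⊗l₍₂₎) = σ^β(h₍₁₎k₍₁₎⊗l)σ^β(h₍₂₎⊗k₍₂₎), and σ^β(h⊗1)=σ^β(1⊗h)=ε(h). In particular, taking σ = ε⊗ε, the coboundary ∂β(h⊗k) := β⁻*(h₍₁₎k₍₁₎) β(h₍₂₎) β(k₍₂₎) is a right 2-cocycle on B. -/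
/-!
STATEMENT 12: If `σ` is a right 2-cocycle on a bialgebra `B` and `β : B → k` is
convolution invertible with `β(1) = 1`, then
`σ^β(h ⊗ l) = β⁻*(h₍₁₎l₍₁₎) σ(h₍₂₎ ⊗ l₍₂₎) β(h₍₃₎) β(l₍₃₎)` is again a right 2-cocycle.
In particular the coboundary `∂β(h ⊗ l) = β⁻*(h₍₁₎l₍₁₎) β(h₍₂₎) β(l₍₂₎)` is a right 2-cocycle.
-/

open scoped TensorProduct

/-- `σ` is a right 2-cocycle on the bialgebra `B`: convolution invertible, satisfies the
right 2-cocycle identity, and is normalized. -/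
def IsRightTwoCocycle {k B : Type} [Field k] [Ring B] [Bialgebra k B]
    (σ : B ⊗[k] B →ₗ[k] k) : Prop :=
  (∃ σinv : B ⊗[k] B →ₗ[k] k,
    ∀ (a b : B) (n m : ℕ) (a1 a2 : Fin n → B) (b1 b2 : Fin m → B),
      Coalgebra.comul (R := k) a = ∑ i, a1 i ⊗ₜ[k] a2 i →
      Coalgebra.comul (R := k) b = ∑ j, b1 j ⊗ₜ[k] b2 j →
      (∑ i, ∑ j, σ (a1 i ⊗ₜ[k] b1 j) * σinv (a2 i ⊗ₜ[k] b2 j)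
          = Coalgebra.counit (R := k) a * Coalgebra.counit (R := k) b) ∧
      (∑ i, ∑ j, σinv (a1 i ⊗ₜ[k] b1 j) * σ (a2 i ⊗ₜ[k] b2 j)
          = Coalgebra.counit (R := k) a * Coalgebra.counit (R := k) b)) ∧
  (∀ (h g l : B) (m p : ℕ) (g1 g2 : Fin m → B) (l1 l2 : Fin p → B),
      Coalgebra.comul (R := k) g = ∑ j, g1 j ⊗ₜ[k] g2 j →
      Coalgebra.comul (R := k) l = ∑ s, l1 s ⊗ₜ[k] l2 s →
      ∀ (n : ℕ) (h1 h2 : Fin n → B),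
      Coalgebra.comul (R := k) h = ∑ i, h1 i ⊗ₜ[k] h2 i →
      ∑ j, ∑ s, σ (h ⊗ₜ[k] (g1 j * l1 s)) * σ (g2 j ⊗ₜ[k] l2 s)
        = ∑ i, ∑ j, σ ((h1 i * g1 j) ⊗ₜ[k] l) * σ (h2 i ⊗ₜ[k] g2 j)) ∧
  (∀ h : B, σ (h ⊗ₜ[k] (1 : B)) = Coalgebra.counit (R := k) h) ∧
  (∀ h : B, σ ((1 : B) ⊗ₜ[k] h) = Coalgebra.counit (R := k) h)

namespace TwistAux

open Coalgebra WithConv TensorProduct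

section General

variable {k C D E : Type} [Field k] [AddCommGroup C] [Module k C] [Coalgebra k C]
  [AddCommGroup D] [Module k D] [Coalgebra k D] [AddCommGroup E] [Module k E] [Coalgebra k E]

/-- The convolution algebra of linear forms on a coalgebra. -/
abbrev Conv (k C : Type) [Field k] [AddCommGroup C] [Module k C] [Coalgebra k C] : Type :=
  WithConv (C →ₗ[k] k)

/-- Precomposition with a coalgebra map, as a monoid map of convolution algebras. -/
noncomputable def pull (φ : C →ₗc[k] D) : Conv k D →* Conv k C where
  toFun f := toConv (f.ofConv.comp φ.toLinearMap)
  map_one' := by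
    ext c
    simp [LinearMap.convOne_def]
  map_mul' f g := by
    have h := LinearMap.convMul_comp_coalgHom_distrib f g φ
    rw [h]

lemma pull_apply (φ : C →ₗc[k] D) (f : Conv k D) (c : C) : (pull φ f) c = f (φ c) := rfl

lemma pull_comp (φ : C →ₗc[k] D) (ψ : D →ₗc[k] E) (f : Conv k E) :
    pull φ (pull ψ f) = pull (ψ.comp φ) f := rfl

/-- First projection. -/
noncomputable def fstH (k C D : Type) [Field k] [AddCommGroup C] [Module k C] [Coalgebra k C]
    [AddCommGroup D] [Module k D] [Coalgebra k D] : C ⊗[k] D →ₗc[k] C :=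
  (Coalgebra.TensorProduct.rid k k C).toCoalgHom.comp
    (Coalgebra.TensorProduct.map (CoalgHom.id k C) (counitCoalgHom k D))

/-- Second projection. -/
noncomputable def sndH (k C D : Type) [Field k] [AddCommGroup C] [Module k C] [Coalgebra k C]
    [AddCommGroup D] [Module k D] [Coalgebra k D] : C ⊗[k] D →ₗc[k] D :=
  (Coalgebra.TensorProduct.lid k D).toCoalgHom.comp
    (Coalgebra.TensorProduct.map (counitCoalgHom k C) (CoalgHom.id k D))

lemma fstH_tmul (c : C) (d : D) : fstH k C D (c ⊗ₜ d) = counit (R := k) d • c := rfl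

lemma sndH_tmul (c : C) (d : D) : sndH k C D (c ⊗ₜ d) = counit (R := k) c • d := rfl

lemma conv_apply {ι : Type} [Fintype ι] (f g : Conv k C) (c : C) (c1 c2 : ι → C)
    (hc : comul (R := k) c = ∑ i, c1 i ⊗ₜ[k] c2 i) :
    (f * g) c = ∑ i, f (c1 i) * g (c2 i) := by
  rw [LinearMap.convMul_apply, hc]
  simp

lemma comul_pair {ι κ : Type} [Fintype ι] [Fintype κ] (c : C) (d : D) (c1 c2 : ι → C)
    (d1 d2 : κ → D) (hc : comul (R := k) c = ∑ i, c1 i ⊗ₜ[k] c2 i)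
    (hd : comul (R := k) d = ∑ j, d1 j ⊗ₜ[k] d2 j) :
    comul (R := k) (c ⊗ₜ[k] d) =
      ∑ p : ι × κ, (c1 p.1 ⊗ₜ[k] d1 p.2) ⊗ₜ[k] (c2 p.1 ⊗ₜ[k] d2 p.2) := by
  rw [TensorProduct.comul_tmul, hc, hd, Fintype.sum_prod_type]
  simp [TensorProduct.sum_tmul, TensorProduct.tmul_sum]
  rw [Finset.sum_comm]

lemma conv_tmul {ι κ : Type} [Fintype ι] [Fintype κ] (f g : Conv k (C ⊗[k] D)) (c : C) (d : D)
    (c1 c2 : ι → C) (d1 d2 : κ → D) (hc : comul (R := k) c = ∑ i, c1 i ⊗ₜ[k] c2 i)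
    (hd : comul (R := k) d = ∑ j, d1 j ⊗ₜ[k] d2 j) :
    (f * g) (c ⊗ₜ[k] d) = ∑ i, ∑ j, f (c1 i ⊗ₜ[k] d1 j) * g (c2 i ⊗ₜ[k] d2 j) := by
  rw [conv_apply f g _ _ _ (comul_pair c d c1 c2 d1 d2 hc hd), Fintype.sum_prod_type]

lemma exists_rep (c : C) : ∃ (n : ℕ) (c1 c2 : Fin n → C),
    comul (R := k) c = ∑ i, c1 i ⊗ₜ[k] c2 i := by
  let r := ℛ k c
  let e := r.index.equivFin
  refine ⟨r.index.card, fun i => r.left (e.symm i), fun i => r.right (e.symm i), ?_⟩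
  rw [e.symm.sum_comp (fun x : r.index => r.left x ⊗ₜ[k] r.right x), ← r.eq,
    Finset.sum_coe_sort r.index (fun x => r.left x ⊗ₜ[k] r.right x)]

lemma sum_counit_left {n : ℕ} (c : C) (c1 c2 : Fin n → C)
    (hc : comul (R := k) c = ∑ i, c1 i ⊗ₜ[k] c2 i) :
    ∑ i, counit (R := k) (c1 i) • c2 i = c := by
  have h := rTensor_counit_comul (R := k) c
  rw [hc] at h
  have := congrArg (TensorProduct.lid k C) h
  simpa using this

lemma sum_counit_right {n : ℕ} (c : C) (c1 c2 : Fin n → C)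
    (hc : comul (R := k) c = ∑ i, c1 i ⊗ₜ[k] c2 i) :
    ∑ i, counit (R := k) (c2 i) • c1 i = c := by
  have h := lTensor_counit_comul (R := k) c
  rw [hc] at h
  have := congrArg (TensorProduct.rid k C) h
  simpa using this

lemma conv_ext2 {f g : Conv k (C ⊗[k] D)} (h : ∀ c d, f (c ⊗ₜ[k] d) = g (c ⊗ₜ[k] d)) :
    f = g := by
  apply WithConv.ofConv_injective
  exact TensorProduct.ext' h

lemma fst_mul_snd (f : Conv k C) (g : Conv k D) (c : C) (d : D) :
    (pull (fstH k C D) f * pull (sndH k C D) g) (c ⊗ₜ[k] d) = f c * g d := by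
  obtain ⟨n, c1, c2, hc⟩ := exists_rep (k := k) c
  obtain ⟨m, d1, d2, hd⟩ := exists_rep (k := k) d
  rw [conv_tmul _ _ c d c1 c2 d1 d2 hc hd]
  conv_rhs => rw [← sum_counit_right c c1 c2 hc, ← sum_counit_left d d1 d2 hd]
  change _ = f.ofConv _ * g.ofConv _
  rw [map_sum, map_sum, Finset.sum_mul_sum]
  refine Finset.sum_congr rfl fun i _ => Finset.sum_congr rfl fun j _ => ?_
  simp only [pull_apply, fstH_tmul, sndH_tmul]
  change f.ofConv _ * g.ofConv _ = _
  simp only [map_smul, smul_eq_mul]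
  ring

lemma snd_mul_fst (f : Conv k C) (g : Conv k D) (c : C) (d : D) :
    (pull (sndH k C D) g * pull (fstH k C D) f) (c ⊗ₜ[k] d) = f c * g d := by
  obtain ⟨n, c1, c2, hc⟩ := exists_rep (k := k) c
  obtain ⟨m, d1, d2, hd⟩ := exists_rep (k := k) d
  rw [conv_tmul _ _ c d c1 c2 d1 d2 hc hd]
  conv_rhs => rw [← sum_counit_left c c1 c2 hc, ← sum_counit_right d d1 d2 hd]
  change _ = f.ofConv _ * g.ofConv _
  rw [map_sum, map_sum, Finset.sum_mul_sum]
  refine Finset.sum_congr rfl fun i _ => Finset.sum_congr rfl fun j _ => ?_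
  simp only [pull_apply, fstH_tmul, sndH_tmul]
  change g.ofConv _ * f.ofConv _ = _
  simp only [map_smul, smul_eq_mul]
  ring

lemma commute_fst_snd (f : Conv k C) (g : Conv k D) :
    Commute (pull (fstH k C D) f) (pull (sndH k C D) g) :=
  conv_ext2 fun c d => by rw [fst_mul_snd, snd_mul_fst]

end General

section Bialg

variable {k B : Type} [Field k] [Ring B] [Bialgebra k B]

/-- Multiplication as a coalgebra map. -/
noncomputable abbrev mulH (k B : Type) [Field k] [Ring B] [Bialgebra k B] : B ⊗[k] B →ₗc[k] B :=
  Bialgebra.mulCoalgHom k B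

/-- `h ⊗ (g ⊗ l) ↦ h ⊗ g l`. -/
noncomputable def idm (k B : Type) [Field k] [Ring B] [Bialgebra k B] :
    B ⊗[k] (B ⊗[k] B) →ₗc[k] B ⊗[k] B :=
  Coalgebra.TensorProduct.map (CoalgHom.id k B) (mulH k B)

/-- Reassociation. -/
noncomputable def asc (k B : Type) [Field k] [Ring B] [Bialgebra k B] :
    B ⊗[k] (B ⊗[k] B) →ₗc[k] (B ⊗[k] B) ⊗[k] B :=
  (Coalgebra.TensorProduct.assoc k k B B B).symm.toCoalgHom

/-- `h ⊗ (g ⊗ l) ↦ h g ⊗ l`. -/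
noncomputable def mid (k B : Type) [Field k] [Ring B] [Bialgebra k B] :
    B ⊗[k] (B ⊗[k] B) →ₗc[k] B ⊗[k] B :=
  (Coalgebra.TensorProduct.map (mulH k B) (CoalgHom.id k B)).comp (asc k B)

/-- `h ⊗ (g ⊗ l) ↦ ε(l) h ⊗ g`. -/
noncomputable def p12 (k B : Type) [Field k] [Ring B] [Bialgebra k B] :
    B ⊗[k] (B ⊗[k] B) →ₗc[k] B ⊗[k] B :=
  (fstH k (B ⊗[k] B) B).comp (asc k B)

/-- `h ⊗ (g ⊗ l) ↦ ε(h) ε(g) l`. -/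
noncomputable def p3 (k B : Type) [Field k] [Ring B] [Bialgebra k B] :
    B ⊗[k] (B ⊗[k] B) →ₗc[k] B :=
  (sndH k (B ⊗[k] B) B).comp (asc k B)

lemma idm_tmul (h g l : B) : idm k B (h ⊗ₜ (g ⊗ₜ l)) = h ⊗ₜ[k] (g * l) := rfl
lemma mid_tmul (h g l : B) : mid k B (h ⊗ₜ (g ⊗ₜ l)) = (h * g) ⊗ₜ[k] l := rfl
lemma p12_tmul (h g l : B) : p12 k B (h ⊗ₜ (g ⊗ₜ l)) = counit (R := k) l • (h ⊗ₜ[k] g) := rfl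
lemma p3_tmul (h g l : B) :
    p3 k B (h ⊗ₜ (g ⊗ₜ l)) = (counit (R := k) g * counit (R := k) h) • l := rfl
lemma mulH_tmul (h g : B) : mulH k B (h ⊗ₜ g) = h * g := rfl

lemma conv_ext3 {f g : Conv k (B ⊗[k] (B ⊗[k] B))}
    (h : ∀ a b c, f (a ⊗ₜ[k] (b ⊗ₜ[k] c)) = g (a ⊗ₜ[k] (b ⊗ₜ[k] c))) : f = g := by
  apply WithConv.ofConv_injective
  apply TensorProduct.ext_threefold'
  exact h

lemma commute_p12_p3 (f : Conv k (B ⊗[k] B)) (g : Conv k B) :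
    Commute (pull (p12 k B) f) (pull (p3 k B) g) :=
  (commute_fst_snd f g).map (pull (asc k B))

/-- Cocycles, in terms of the convolution algebras. -/
structure CC (s : Conv k (B ⊗[k] B)) : Prop where
  inv : ∃ t : Conv k (B ⊗[k] B), s * t = 1 ∧ t * s = 1
  coc : pull (idm k B) s * pull (sndH k B (B ⊗[k] B)) s = pull (mid k B) s * pull (p12 k B) s
  right : ∀ h : B, s (h ⊗ₜ[k] (1 : B)) = counit (R := k) h
  left : ∀ h : B, s ((1 : B) ⊗ₜ[k] h) = counit (R := k) h

lemma lhs_apply (s : Conv k (B ⊗[k] B)) (h g l : B) (m p : ℕ) (g1 g2 : Fin m → B)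
    (l1 l2 : Fin p → B)
    (hg : comul (R := k) g = ∑ j, g1 j ⊗ₜ[k] g2 j)
    (hl : comul (R := k) l = ∑ j, l1 j ⊗ₜ[k] l2 j) :
    (pull (idm k B) s * pull (sndH k B (B ⊗[k] B)) s) (h ⊗ₜ[k] (g ⊗ₜ[k] l))
      = ∑ j, ∑ r, s (h ⊗ₜ[k] (g1 j * l1 r)) * s (g2 j ⊗ₜ[k] l2 r) := by
  obtain ⟨n, h1, h2, hh⟩ := exists_rep (k := k) h
  rw [conv_tmul _ _ h _ h1 h2 _ _ hh (comul_pair g l g1 g2 l1 l2 hg hl), Finset.sum_comm,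
    Fintype.sum_prod_type]
  refine Finset.sum_congr rfl fun i _ => Finset.sum_congr rfl fun j _ => ?_
  conv_rhs => rw [← sum_counit_right h h1 h2 hh]
  simp only [pull_apply, idm_tmul, sndH_tmul]
  change ∑ x, s.ofConv _ * s.ofConv _ = s.ofConv _ * s.ofConv _
  simp only [TensorProduct.sum_tmul, map_sum, ← TensorProduct.smul_tmul', map_smul, smul_eq_mul,
    Finset.sum_mul]
  exact Finset.sum_congr rfl fun x _ => by ring

lemma rhs_apply (s : Conv k (B ⊗[k] B)) (h g l : B) (n m : ℕ) (h1 h2 : Fin n → B)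
    (g1 g2 : Fin m → B)
    (hh : comul (R := k) h = ∑ j, h1 j ⊗ₜ[k] h2 j)
    (hg : comul (R := k) g = ∑ j, g1 j ⊗ₜ[k] g2 j) :
    (pull (mid k B) s * pull (p12 k B) s) (h ⊗ₜ[k] (g ⊗ₜ[k] l))
      = ∑ i, ∑ j, s ((h1 i * g1 j) ⊗ₜ[k] l) * s (h2 i ⊗ₜ[k] g2 j) := by
  obtain ⟨p, l1, l2, hl⟩ := exists_rep (k := k) l
  rw [conv_tmul _ _ h _ h1 h2 _ _ hh (comul_pair g l g1 g2 l1 l2 hg hl)]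
  refine Finset.sum_congr rfl fun i _ => ?_
  rw [Fintype.sum_prod_type]
  refine Finset.sum_congr rfl fun j _ => ?_
  conv_rhs => rw [← sum_counit_right l l1 l2 hl]
  simp only [pull_apply, mid_tmul, p12_tmul]
  change ∑ x, s.ofConv _ * s.ofConv _ = s.ofConv _ * s.ofConv _
  simp only [TensorProduct.tmul_sum, map_sum, TensorProduct.tmul_smul, map_smul, smul_eq_mul,
    Finset.sum_mul]
  exact Finset.sum_congr rfl fun x _ => by ring

lemma one_tmul (a b : B) :
    (1 : Conv k (B ⊗[k] B)) (a ⊗ₜ[k] b) = counit (R := k) a * counit (R := k) b := by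
  simp [mul_comm]

lemma cc_iff (σ : B ⊗[k] B →ₗ[k] k) : IsRightTwoCocycle σ ↔ CC (toConv σ) := by
  constructor
  · rintro ⟨⟨τ, hτ⟩, hc, hr, hl⟩
    refine ⟨⟨toConv τ, ?_, ?_⟩, ?_, hr, hl⟩
    · refine conv_ext2 fun a b => ?_
      obtain ⟨n, a1, a2, ha⟩ := exists_rep (k := k) a
      obtain ⟨m, b1, b2, hb⟩ := exists_rep (k := k) b
      rw [conv_tmul _ _ a b a1 a2 b1 b2 ha hb, one_tmul]
      exact (hτ a b n m a1 a2 b1 b2 ha hb).1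
    · refine conv_ext2 fun a b => ?_
      obtain ⟨n, a1, a2, ha⟩ := exists_rep (k := k) a
      obtain ⟨m, b1, b2, hb⟩ := exists_rep (k := k) b
      rw [conv_tmul _ _ a b a1 a2 b1 b2 ha hb, one_tmul]
      exact (hτ a b n m a1 a2 b1 b2 ha hb).2
    · refine conv_ext3 fun h g l => ?_
      obtain ⟨n, h1, h2, hh⟩ := exists_rep (k := k) h
      obtain ⟨m, g1, g2, hg⟩ := exists_rep (k := k) g
      obtain ⟨p, l1, l2, hl⟩ := exists_rep (k := k) l
      rw [lhs_apply _ h g l m p g1 g2 l1 l2 hg hl, rhs_apply _ h g l n m h1 h2 g1 g2 hh hg]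
      exact hc h g l m p g1 g2 l1 l2 hg hl n h1 h2 hh
  · rintro ⟨⟨τ, h1, h2⟩, hc, hr, hl⟩
    refine ⟨⟨τ.ofConv, ?_⟩, ?_, hr, hl⟩
    · intro a b n m a1 a2 b1 b2 ha hb
      rw [← one_tmul]
      constructor
      · rw [← h1, conv_tmul _ _ a b a1 a2 b1 b2 ha hb]
      · rw [← h2, conv_tmul _ _ a b a1 a2 b1 b2 ha hb]
    · intro h g l m p g1 g2 l1 l2 hg hl n h1 h2 hh
      have := congrArg (fun f : Conv k (B ⊗[k] (B ⊗[k] B)) => f (h ⊗ₜ[k] (g ⊗ₜ[k] l))) hc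
      rw [lhs_apply _ h g l m p g1 g2 l1 l2 hg hl, rhs_apply _ h g l n m h1 h2 g1 g2 hh hg] at this
      exact this

/-- The twist of `s` by `b`, with `b'` the inverse of `b`. -/
noncomputable def twist (s : Conv k (B ⊗[k] B)) (b b' : Conv k B) : Conv k (B ⊗[k] B) :=
  pull (mulH k B) b' * s * (pull (fstH k B B) b * pull (sndH k B B) b)

/-- `h ↦ h ⊗ 1`. -/
noncomputable def inl (k B : Type) [Field k] [Ring B] [Bialgebra k B] : B →ₗc[k] B ⊗[k] B :=
  (Coalgebra.TensorProduct.map (CoalgHom.id k B) (Bialgebra.unitBialgHom k B).toCoalgHom).comp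
    (Coalgebra.TensorProduct.rid k k B).symm.toCoalgHom

/-- `h ↦ 1 ⊗ h`. -/
noncomputable def inr (k B : Type) [Field k] [Ring B] [Bialgebra k B] : B →ₗc[k] B ⊗[k] B :=
  (Coalgebra.TensorProduct.map (Bialgebra.unitBialgHom k B).toCoalgHom (CoalgHom.id k B)).comp
    (Coalgebra.TensorProduct.lid k B).symm.toCoalgHom

lemma inl_apply (h : B) : inl k B h = h ⊗ₜ[k] (1 : B) := by
  change h ⊗ₜ[k] (algebraMap k B 1) = _
  rw [map_one]

lemma inr_apply (h : B) : inr k B h = (1 : B) ⊗ₜ[k] h := by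
  change (algebraMap k B 1) ⊗ₜ[k] h = _
  rw [map_one]

lemma twist_cc (s : Conv k (B ⊗[k] B)) (hs : CC s) (b b' : Conv k B) (hb : b * b' = 1)
    (hb' : b' * b = 1) (h1 : b (1 : B) = 1) : CC (twist s b b') := by
  obtain ⟨⟨t, hst, hts⟩, hc, hr, hl⟩ := hs
  have pm : ∀ {C : Type} [AddCommGroup C] [Module k C] [Coalgebra k C] (φ : C →ₗc[k] B),
      pull φ b * pull φ b' = 1 := by
    intro C _ _ _ φ
    rw [← map_mul, hb, map_one]
  have pm' : ∀ {C : Type} [AddCommGroup C] [Module k C] [Coalgebra k C] (φ : C →ₗc[k] B),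
      pull φ b' * pull φ b = 1 := by
    intro C _ _ _ φ
    rw [← map_mul, hb', map_one]
  refine ⟨?_, ?_, ?_, ?_⟩
  · have u1 : IsUnit (pull (mulH k B) b') := ⟨⟨_, _, pm' _, pm _⟩, rfl⟩
    have u2 : IsUnit s := ⟨⟨_, _, hst, hts⟩, rfl⟩
    have u3 : IsUnit (pull (fstH k B B) b) := ⟨⟨_, _, pm _, pm' _⟩, rfl⟩
    have u4 : IsUnit (pull (sndH k B B) b) := ⟨⟨_, _, pm _, pm' _⟩, rfl⟩
    obtain ⟨u, hu⟩ := (u1.mul u2).mul (u3.mul u4)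
    refine ⟨(↑u⁻¹ : Conv k (B ⊗[k] B)), ?_, ?_⟩
    · rw [twist, ← hu, Units.mul_inv]
    · rw [twist, ← hu, Units.inv_mul]
  · have e1 : ∀ f : Conv k B, pull (idm k B) (pull (mulH k B) f)
        = pull (mid k B) (pull (mulH k B) f) := fun f => conv_ext3 fun x y z => by
      simp only [pull_apply, idm_tmul, mid_tmul, mulH_tmul, mul_assoc]
    have e2 : ∀ f : Conv k B, pull (idm k B) (pull (sndH k B B) f)
        = pull (sndH k B (B ⊗[k] B)) (pull (mulH k B) f) := fun f => conv_ext3 fun x y z => by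
      simp only [pull_apply, idm_tmul, sndH_tmul, map_smul, mulH_tmul]
    have e3 : ∀ f : Conv k B, pull (idm k B) (pull (fstH k B B) f)
        = pull (fstH k B (B ⊗[k] B)) f := fun f => conv_ext3 fun x y z => by
      simp only [pull_apply, idm_tmul, fstH_tmul, TensorProduct.counit_tmul, smul_eq_mul,
        Bialgebra.counit_mul]
      rw [mul_comm]
    have e4 : ∀ f : Conv k B, pull (mid k B) (pull (fstH k B B) f)
        = pull (p12 k B) (pull (mulH k B) f) := fun f => conv_ext3 fun x y z => by
      simp only [pull_apply, mid_tmul, fstH_tmul, p12_tmul, map_smul, mulH_tmul]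
    have e5 : ∀ f : Conv k B, pull (mid k B) (pull (sndH k B B) f)
        = pull (p3 k B) f := fun f => conv_ext3 fun x y z => by
      simp only [pull_apply, mid_tmul, sndH_tmul, p3_tmul, Bialgebra.counit_mul]
      rw [mul_comm]
    have e6 : ∀ f : Conv k B, pull (p12 k B) (pull (fstH k B B) f)
        = pull (fstH k B (B ⊗[k] B)) f := fun f => conv_ext3 fun x y z => by
      simp only [pull_apply, p12_tmul, fstH_tmul, map_smul, TensorProduct.counit_tmul, mul_assoc,
        smul_eq_mul]
    have e7 : ∀ f : Conv k B, pull (p12 k B) (pull (sndH k B B) f)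
        = pull (sndH k B (B ⊗[k] B)) (pull (fstH k B B) f) := fun f => conv_ext3 fun x y z => by
      simp only [pull_apply, p12_tmul, sndH_tmul, fstH_tmul, map_smul, smul_smul]
      rw [mul_comm]
    have e8 : ∀ f : Conv k B, pull (sndH k B (B ⊗[k] B)) (pull (sndH k B B) f)
        = pull (p3 k B) f := fun f => conv_ext3 fun x y z => by
      simp only [pull_apply, p3_tmul, sndH_tmul, map_smul, smul_smul]
      rw [mul_comm]
    have c1 := commute_fst_snd (k := k) (C := B) (D := B ⊗[k] B) b s
    have c2 : Commute (pull (p3 k B) b) (pull (p12 k B) (pull (mulH k B) b' * s)) :=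
      (commute_p12_p3 _ _).symm
    have c3 : Commute (pull (p3 k B) b)
        (pull (p12 k B) (pull (fstH k B B) b * pull (sndH k B B) b)) :=
      (commute_p12_p3 _ _).symm
    have n1 := pm ((mulH k B).comp (sndH k B (B ⊗[k] B)))
    have n2 := pm ((mulH k B).comp (p12 k B))
    rw [← pull_comp, ← pull_comp] at n1 n2
    simp only [twist, map_mul, e1, e2, e3, e4, e5, e6, e7, e8] at c2 c3 ⊢
    generalize pull (mid k B) (pull (mulH k B) b') = a at *
    generalize pull (idm k B) s = S at *
    generalize pull (mid k B) s = S' at *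
    generalize pull (fstH k B (B ⊗[k] B)) b = b1 at *
    generalize pull (sndH k B (B ⊗[k] B)) (pull (fstH k B B) b) = b2 at *
    generalize pull (p3 k B) b = b3 at *
    generalize pull (sndH k B (B ⊗[k] B)) s = T at *
    generalize pull (p12 k B) s = T' at *
    generalize pull (sndH k B (B ⊗[k] B)) (pull (mulH k B) b) = M at *
    generalize pull (sndH k B (B ⊗[k] B)) (pull (mulH k B) b') = M' at *
    generalize pull (p12 k B) (pull (mulH k B) b) = N at *
    generalize pull (p12 k B) (pull (mulH k B) b') = N' at *
    calc a * S * (b1 * M) * (M' * T * (b2 * b3))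
        = a * S * b1 * (M * M') * T * (b2 * b3) := by simp only [mul_assoc]
      _ = a * S * (b1 * T) * (b2 * b3) := by rw [n1]; simp only [mul_assoc, one_mul]
      _ = a * (S * T) * (b1 * b2 * b3) := by rw [c1.eq]; simp only [mul_assoc]
      _ = a * (S' * T') * (b3 * (b1 * b2)) := by rw [hc, c3.eq]
      _ = a * S' * ((N * N') * T') * b3 * (b1 * b2) := by rw [n2]; simp only [mul_assoc, one_mul]
      _ = a * S' * N * ((N' * T') * b3) * (b1 * b2) := by simp only [mul_assoc]
      _ = a * S' * (N * b3) * (N' * T' * (b1 * b2)) := by rw [← c2.eq]; simp only [mul_assoc]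
  · intro h
    rw [← inl_apply, ← pull_apply]
    have e1 : pull (inl k B) (pull (mulH k B) b') = b' := by
      ext x
      simp only [pull_apply, inl_apply, mulH_tmul, mul_one]
    have e2 : pull (inl k B) (pull (fstH k B B) b) = b := by
      ext x
      simp only [pull_apply, inl_apply, fstH_tmul, Bialgebra.counit_one, one_smul]
    have e3 : pull (inl k B) (pull (sndH k B B) b) = 1 := by
      ext x
      simp only [pull_apply, inl_apply, sndH_tmul]
      change b.ofConv _ = _
      rw [map_smul]
      change _ • b 1 = _
      simp [h1]
    have e4 : pull (inl k B) s = 1 := by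
      ext x
      simp only [pull_apply, inl_apply, hr]
      simp
    simp only [twist, map_mul, e1, e2, e3, e4, mul_one, hb']
    simp
  · intro h
    rw [← inr_apply, ← pull_apply]
    have e1 : pull (inr k B) (pull (mulH k B) b') = b' := by
      ext x
      simp only [pull_apply, inr_apply, mulH_tmul, one_mul]
    have e2 : pull (inr k B) (pull (sndH k B B) b) = b := by
      ext x
      simp only [pull_apply, inr_apply, sndH_tmul, Bialgebra.counit_one, one_smul]
    have e3 : pull (inr k B) (pull (fstH k B B) b) = 1 := by
      ext x
      simp only [pull_apply, inr_apply, fstH_tmul]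
      change b.ofConv _ = _
      rw [map_smul]
      change _ • b 1 = _
      simp [h1]
    have e4 : pull (inr k B) s = 1 := by
      ext x
      simp only [pull_apply, inr_apply, hl]
      simp
    simp only [twist, map_mul, e1, e2, e3, e4, mul_one, one_mul, hb']
    simp

lemma one_cc : CC (1 : Conv k (B ⊗[k] B)) := by
  refine ⟨⟨1, by simp, by simp⟩, ?_, ?_, ?_⟩
  · simp only [map_one]
  · intro h
    rw [one_tmul]; simp
  · intro h
    rw [one_tmul]; simp

end Bialg

end TwistAux

theorem cohomologous_twist_is_two_cocycle
    {k B : Type} [Field k] [Ring B] [Bialgebra k B]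
    (σ : B ⊗[k] B →ₗ[k] k) (hσ : IsRightTwoCocycle σ)
    (β βinv : B →ₗ[k] k)
    (hβ1 : β (1 : B) = 1)
    -- `βinv` is the convolution inverse `β⁻*` of `β`
    (hβinv : ∀ (h : B) (n : ℕ) (h1 h2 : Fin n → B),
      Coalgebra.comul (R := k) h = ∑ i, h1 i ⊗ₜ[k] h2 i →
      (∑ i, β (h1 i) * βinv (h2 i) = Coalgebra.counit (R := k) h) ∧
      (∑ i, βinv (h1 i) * β (h2 i) = Coalgebra.counit (R := k) h))
    -- `σβ` is the map `σ^β(h ⊗ l) = β⁻*(h₍₁₎l₍₁₎) σ(h₍₂₎ ⊗ l₍₂₎) β(h₍₃₎) β(l₍₃₎)`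
    (σβ : B ⊗[k] B →ₗ[k] k)
    (hσβ : ∀ (h l : B) (n : ℕ) (h1 h2 : Fin n → B)
        (p : Fin n → ℕ) (hh1 hh2 : (i : Fin n) → Fin (p i) → B)
        (m : ℕ) (l1 l2 : Fin m → B)
        (q : Fin m → ℕ) (ll1 ll2 : (j : Fin m) → Fin (q j) → B),
      Coalgebra.comul (R := k) h = ∑ i, h1 i ⊗ₜ[k] h2 i →
      (∀ i, Coalgebra.comul (R := k) (h2 i) = ∑ i', hh1 i i' ⊗ₜ[k] hh2 i i') →
      Coalgebra.comul (R := k) l = ∑ j, l1 j ⊗ₜ[k] l2 j →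
      (∀ j, Coalgebra.comul (R := k) (l2 j) = ∑ j', ll1 j j' ⊗ₜ[k] ll2 j j') →
      σβ (h ⊗ₜ[k] l)
        = ∑ i, ∑ i', ∑ j, ∑ j',
            βinv (h1 i * l1 j) * σ (hh1 i i' ⊗ₜ[k] ll1 j j') * β (hh2 i i') * β (ll2 j j'))
    -- `dβ` is the coboundary `∂β(h ⊗ l) = β⁻*(h₍₁₎l₍₁₎) β(h₍₂₎) β(l₍₂₎)`
    (dβ : B ⊗[k] B →ₗ[k] k)
    (hdβ : ∀ (h l : B) (n : ℕ) (h1 h2 : Fin n → B) (m : ℕ) (l1 l2 : Fin m → B),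
      Coalgebra.comul (R := k) h = ∑ i, h1 i ⊗ₜ[k] h2 i →
      Coalgebra.comul (R := k) l = ∑ j, l1 j ⊗ₜ[k] l2 j →
      dβ (h ⊗ₜ[k] l) = ∑ i, ∑ j, βinv (h1 i * l1 j) * β (h2 i) * β (l2 j)) :
    IsRightTwoCocycle σβ ∧ IsRightTwoCocycle dβ := by
  have hb : (WithConv.toConv β * WithConv.toConv βinv : TwistAux.Conv k B) = 1 := by
    ext h
    obtain ⟨n, h1, h2, hh⟩ := TwistAux.exists_rep (k := k) h
    rw [TwistAux.conv_apply _ _ h h1 h2 hh]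
    exact (hβinv h n h1 h2 hh).1
  have hb' : (WithConv.toConv βinv * WithConv.toConv β : TwistAux.Conv k B) = 1 := by
    ext h
    obtain ⟨n, h1, h2, hh⟩ := TwistAux.exists_rep (k := k) h
    rw [TwistAux.conv_apply _ _ h h1 h2 hh]
    exact (hβinv h n h1 h2 hh).2
  constructor
  · rw [TwistAux.cc_iff]
    have e : (WithConv.toConv σβ : TwistAux.Conv k (B ⊗[k] B)) =
        TwistAux.twist (WithConv.toConv σ) (WithConv.toConv β) (WithConv.toConv βinv) := by
      refine TwistAux.conv_ext2 fun h l => ?_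
      obtain ⟨n, h1, h2, hh⟩ := TwistAux.exists_rep (k := k) h
      obtain ⟨m, l1, l2, hl⟩ := TwistAux.exists_rep (k := k) l
      choose p hh1 hh2 hhh using fun i => TwistAux.exists_rep (k := k) (h2 i)
      choose q ll1 ll2 hll using fun i => TwistAux.exists_rep (k := k) (l2 i)
      refine (hσβ h l n h1 h2 p hh1 hh2 m l1 l2 q ll1 ll2 hh hhh hl hll).trans ?_
      rw [TwistAux.twist, mul_assoc, TwistAux.conv_tmul _ _ h l h1 h2 l1 l2 hh hl]
      refine Finset.sum_congr rfl fun i _ => ?_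
      rw [Finset.sum_comm]
      refine Finset.sum_congr rfl fun j _ => ?_
      rw [TwistAux.conv_tmul _ _ _ _ _ _ _ _ (hhh i) (hll j), Finset.mul_sum]
      refine Finset.sum_congr rfl fun i' _ => ?_
      rw [Finset.mul_sum]
      refine Finset.sum_congr rfl fun j' _ => ?_
      rw [TwistAux.fst_mul_snd, TwistAux.pull_apply, TwistAux.mulH_tmul]
      simp only [mul_assoc]
    rw [e]
    exact TwistAux.twist_cc _ ((TwistAux.cc_iff σ).1 hσ) _ _ hb hb' hβ1
  · rw [TwistAux.cc_iff]
    have e : (WithConv.toConv dβ : TwistAux.Conv k (B ⊗[k] B)) =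
        TwistAux.twist 1 (WithConv.toConv β) (WithConv.toConv βinv) := by
      refine TwistAux.conv_ext2 fun h l => ?_
      obtain ⟨n, h1, h2, hh⟩ := TwistAux.exists_rep (k := k) h
      obtain ⟨m, l1, l2, hl⟩ := TwistAux.exists_rep (k := k) l
      refine (hdβ h l n h1 h2 m l1 l2 hh hl).trans ?_
      rw [TwistAux.twist, mul_one, TwistAux.conv_tmul _ _ h l h1 h2 l1 l2 hh hl]
      refine Finset.sum_congr rfl fun i _ => Finset.sum_congr rfl fun j _ => ?_
      rw [TwistAux.fst_mul_snd, TwistAux.pull_apply, TwistAux.mulH_tmul]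
      simp only [mul_assoc]
    rw [e]
    exact TwistAux.twist_cc _ TwistAux.one_cc _ _ hb hb' hβ1
end

section
/- Let B be a bialgebra over a field k, σ a right 2-cocycle on B, β: B→k a convolution-invertible linear map with β(1)=1, and let τ := σ^β be the cohomologous cocycle τ(h⊗k) = β⁻*(h₍₁₎k₍₁₎)σ(h₍₂₎⊗k₍₂₎)β(h₍₃₎)β(k₍₃₎). Then φ := id∗β, φ(h) = h₍₁₎β(h₍₂₎), is an isomorphism of left B-comodule algebras from B_τ to B_σ: φ(g·_τ h) = φ(g)·_σ φ(h), φ(1)=1, φ is bijective with inverse h ↦ h₍₁₎β⁻*(h₍₂₎), and Δ(φ(h)) = h₍₁₎ ⊗ φ(h₍₂₎). -/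
/-!
STATEMENT 13: For a right 2-cocycle `σ` on `B`, a convolution-invertible `β : B → k`
with `β(1)=1`, and `τ := σ^β` the cohomologous cocycle, the map
`φ := id ∗ β : h ↦ h₍₁₎ β(h₍₂₎)` is an isomorphism of left `B`-comodule algebras
`B_τ → B_σ`.
-/

open scoped TensorProduct

noncomputable section

/-- The map `id ∗ β : h ↦ h₍₁₎ β(h₍₂₎)`. -/
def convWith {k B : Type} [Field k] [Ring B] [Bialgebra k B] (β : B →ₗ[k] k) :
    B →ₗ[k] B :=
  (TensorProduct.rid k B).toLinearMap ∘ₗ LinearMap.lTensor B β ∘ₗ Coalgebra.comul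

section Helpers
open TensorProduct Coalgebra

/-- General version of `convWith` for a coalgebra. -/
def cw {k C : Type} [Field k] [AddCommGroup C] [Module k C] [Coalgebra k C] (s : C →ₗ[k] k) :
    C →ₗ[k] C :=
  (TensorProduct.rid k C).toLinearMap ∘ₗ LinearMap.lTensor C s ∘ₗ Coalgebra.comul

variable {k C D : Type} [Field k] [AddCommGroup C] [Module k C] [Coalgebra k C]
  [AddCommGroup D] [Module k D] [Coalgebra k D]

lemma cw_sum (s : C →ₗ[k] k) (c : C) {n : ℕ} (c1 c2 : Fin n → C)
    (h : comul (R := k) c = ∑ i, c1 i ⊗ₜ[k] c2 i) : cw s c = ∑ i, s (c2 i) • c1 i := by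
  simp [cw, h]

lemma cw_comul (t : C →ₗ[k] k) (c : C) :
    comul (R := k) (cw t c) = LinearMap.lTensor C (cw t) (comul (R := k) c) := by
  have h1 : ∀ x : C ⊗[k] C,
      LinearMap.lTensor C ((TensorProduct.rid k C).toLinearMap ∘ₗ LinearMap.lTensor C t)
        (TensorProduct.assoc k C C C (LinearMap.rTensor C comul x))
      = comul (R := k) ((TensorProduct.rid k C) (LinearMap.lTensor C t x)) := by
    intro x
    induction x with
    | zero => simp
    | add x y hx hy => simp only [map_add, hx, hy]
    | tmul x y =>
      simp only [LinearMap.rTensor_tmul, LinearMap.lTensor_tmul, TensorProduct.rid_tmul, map_smul]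
      generalize (comul (R := k) x) = z
      induction z with
      | zero => simp
      | add x y hx hy => simp only [map_add, hx, hy, add_tmul, smul_add]
      | tmul a b => simp
  have h2 := h1 (comul c)
  rw [Coalgebra.coassoc_apply] at h2
  simp only [cw, LinearMap.comp_apply, LinearEquiv.coe_coe, LinearMap.lTensor_comp] at h2 ⊢
  exact h2.symm

lemma cw_cw (s t : C →ₗ[k] k) (c : C) : cw s (cw t c) = cw (s ∘ₗ cw t) c := by
  conv_lhs => rw [cw]
  simp only [LinearMap.comp_apply, cw_comul]
  rw [← LinearMap.comp_apply (LinearMap.lTensor C s), ← LinearMap.lTensor_comp]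
  rfl

lemma cw_counit (c : C) : cw (counit (R := k)) c = c := by
  simp [cw]

lemma cw_map (f : D →ₗ[k] C) (hf : ∀ d, comul (R := k) (f d) = TensorProduct.map f f (comul d))
    (s : C →ₗ[k] k) (d : D) : cw s (f d) = f (cw (s ∘ₗ f) d) := by
  simp only [cw, LinearMap.comp_apply, hf]
  generalize (comul (R := k) d) = z
  induction z with
  | zero => simp
  | add x y hx hy => simp only [map_add, hx, hy]
  | tmul a b => simp

lemma exists_fin (c : C) : ∃ (n : ℕ) (c1 c2 : Fin n → C),
    comul (R := k) c = ∑ i, c1 i ⊗ₜ[k] c2 i := by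
  generalize (comul (R := k) c) = z
  induction z with
  | zero => exact ⟨0, fun _ => 0, fun _ => 0, by simp⟩
  | tmul a b => exact ⟨1, fun _ => a, fun _ => b, by simp⟩
  | add x y hx hy =>
    obtain ⟨n, a, b, rfl⟩ := hx
    obtain ⟨m, a', b', rfl⟩ := hy
    exact ⟨n + m, Fin.append a a', Fin.append b b', by simp [Fin.sum_univ_add]⟩

lemma comul_sum_tmul (c : C) (d : D) {n m : ℕ} (c1 c2 : Fin n → C) (d1 d2 : Fin m → D)
    (hc : comul (R := k) c = ∑ i, c1 i ⊗ₜ[k] c2 i)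
    (hd : comul (R := k) d = ∑ i, d1 i ⊗ₜ[k] d2 i) :
    comul (R := k) (c ⊗ₜ[k] d)
      = ∑ i, ∑ j, (c1 i ⊗ₜ[k] d1 j) ⊗ₜ[k] (c2 i ⊗ₜ[k] d2 j) := by
  rw [TensorProduct.comul_tmul, hc, hd]
  simp only [TensorProduct.sum_tmul, TensorProduct.tmul_sum, map_sum,
    AlgebraTensorModule.tensorTensorTensorComm_tmul]
  try rw [Finset.sum_comm]

lemma cw_sum_tmul (s : C ⊗[k] D →ₗ[k] k)
    (c : C) (d : D) {n m : ℕ} (c1 c2 : Fin n → C) (d1 d2 : Fin m → D)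
    (hc : comul (R := k) c = ∑ i, c1 i ⊗ₜ[k] c2 i)
    (hd : comul (R := k) d = ∑ i, d1 i ⊗ₜ[k] d2 i) :
    cw s (c ⊗ₜ[k] d) = ∑ i, ∑ j, s (c2 i ⊗ₜ[k] d2 j) • (c1 i ⊗ₜ[k] d1 j) := by
  simp [cw, comul_sum_tmul c d c1 c2 d1 d2 hc hd]

/-- `s ⊗ t` as a functional on the tensor product. -/
def ff (s : C →ₗ[k] k) (t : D →ₗ[k] k) : C ⊗[k] D →ₗ[k] k :=
  LinearMap.mul' k k ∘ₗ TensorProduct.map s t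

lemma cw_ff (s : C →ₗ[k] k) (t : D →ₗ[k] k) (c : C) (d : D) :
    cw (ff s t) (c ⊗ₜ[k] d) = cw s c ⊗ₜ[k] cw t d := by
  obtain ⟨n, c1, c2, hc⟩ := exists_fin (k := k) c
  obtain ⟨m, d1, d2, hd⟩ := exists_fin (k := k) d
  rw [cw_sum_tmul _ c d c1 c2 d1 d2 hc hd, cw_sum s c c1 c2 hc, cw_sum t d d1 d2 hd]
  simp only [TensorProduct.sum_tmul, TensorProduct.tmul_sum, ff, LinearMap.comp_apply,
    TensorProduct.map_tmul, LinearMap.mul'_apply, TensorProduct.smul_tmul_smul]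
  rw [Finset.sum_comm]

lemma comul_mul' {B : Type} [Ring B] [Bialgebra k B] (x : B ⊗[k] B) :
    comul (R := k) (LinearMap.mul' k B x)
      = TensorProduct.map (LinearMap.mul' k B) (LinearMap.mul' k B) (comul (R := k) x) := by
  induction x with
  | zero => simp
  | add x y hx hy => simp only [map_add, hx, hy]
  | tmul a b =>
    obtain ⟨n, c1, c2, hc⟩ := exists_fin (k := k) a
    obtain ⟨m, d1, d2, hd⟩ := exists_fin (k := k) b
    rw [comul_sum_tmul a b c1 c2 d1 d2 hc hd, LinearMap.mul'_apply, Bialgebra.comul_mul, hc, hd]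
    simp [Finset.sum_mul_sum]

end Helpers

theorem twist_by_cohomologous_cocycles_isomorphic
    {k B : Type} [Field k] [Ring B] [Bialgebra k B]
    (σ : B ⊗[k] B →ₗ[k] k)
    -- `σ` is a right 2-cocycle
    (σinv : B ⊗[k] B →ₗ[k] k)
    (hσconv : ∀ (a b : B) (n m : ℕ) (a1 a2 : Fin n → B) (b1 b2 : Fin m → B),
      Coalgebra.comul (R := k) a = ∑ i, a1 i ⊗ₜ[k] a2 i →
      Coalgebra.comul (R := k) b = ∑ j, b1 j ⊗ₜ[k] b2 j →
      (∑ i, ∑ j, σ (a1 i ⊗ₜ[k] b1 j) * σinv (a2 i ⊗ₜ[k] b2 j)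
          = Coalgebra.counit (R := k) a * Coalgebra.counit (R := k) b) ∧
      (∑ i, ∑ j, σinv (a1 i ⊗ₜ[k] b1 j) * σ (a2 i ⊗ₜ[k] b2 j)
          = Coalgebra.counit (R := k) a * Coalgebra.counit (R := k) b))
    (hσcocycle : ∀ (h g l : B) (m p : ℕ) (g1 g2 : Fin m → B) (l1 l2 : Fin p → B),
      Coalgebra.comul (R := k) g = ∑ j, g1 j ⊗ₜ[k] g2 j →
      Coalgebra.comul (R := k) l = ∑ s, l1 s ⊗ₜ[k] l2 s →
      ∀ (n : ℕ) (h1 h2 : Fin n → B),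
      Coalgebra.comul (R := k) h = ∑ i, h1 i ⊗ₜ[k] h2 i →
      ∑ j, ∑ s, σ (h ⊗ₜ[k] (g1 j * l1 s)) * σ (g2 j ⊗ₜ[k] l2 s)
        = ∑ i, ∑ j, σ ((h1 i * g1 j) ⊗ₜ[k] l) * σ (h2 i ⊗ₜ[k] g2 j))
    (hσ1 : ∀ h : B, σ (h ⊗ₜ[k] (1 : B)) = Coalgebra.counit (R := k) h)
    (hσ1' : ∀ h : B, σ ((1 : B) ⊗ₜ[k] h) = Coalgebra.counit (R := k) h)
    (β βinv : B →ₗ[k] k)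
    (hβ1 : β (1 : B) = 1)
    (hβinv : ∀ (h : B) (n : ℕ) (h1 h2 : Fin n → B),
      Coalgebra.comul (R := k) h = ∑ i, h1 i ⊗ₜ[k] h2 i →
      (∑ i, β (h1 i) * βinv (h2 i) = Coalgebra.counit (R := k) h) ∧
      (∑ i, βinv (h1 i) * β (h2 i) = Coalgebra.counit (R := k) h))
    -- `τ = σ^β` is the cohomologous cocycle
    (τ : B ⊗[k] B →ₗ[k] k)
    (hτ : ∀ (h l : B) (n : ℕ) (h1 h2 : Fin n → B)
        (p : Fin n → ℕ) (hh1 hh2 : (i : Fin n) → Fin (p i) → B)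
        (m : ℕ) (l1 l2 : Fin m → B)
        (q : Fin m → ℕ) (ll1 ll2 : (j : Fin m) → Fin (q j) → B),
      Coalgebra.comul (R := k) h = ∑ i, h1 i ⊗ₜ[k] h2 i →
      (∀ i, Coalgebra.comul (R := k) (h2 i) = ∑ i', hh1 i i' ⊗ₜ[k] hh2 i i') →
      Coalgebra.comul (R := k) l = ∑ j, l1 j ⊗ₜ[k] l2 j →
      (∀ j, Coalgebra.comul (R := k) (l2 j) = ∑ j', ll1 j j' ⊗ₜ[k] ll2 j j') →
      τ (h ⊗ₜ[k] l)
        = ∑ i, ∑ i', ∑ j, ∑ j',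
            βinv (h1 i * l1 j) * σ (hh1 i i' ⊗ₜ[k] ll1 j j') * β (hh2 i i') * β (ll2 j j'))
    -- the twisted products of `B_σ` and `B_τ`
    (mσ mτ : B ⊗[k] B →ₗ[k] B)
    (hmσ : ∀ (g h : B) (n m : ℕ) (g1 g2 : Fin n → B) (h1 h2 : Fin m → B),
      Coalgebra.comul (R := k) g = ∑ i, g1 i ⊗ₜ[k] g2 i →
      Coalgebra.comul (R := k) h = ∑ j, h1 j ⊗ₜ[k] h2 j →
      mσ (g ⊗ₜ[k] h) = ∑ i, ∑ j, σ (g2 i ⊗ₜ[k] h2 j) • (g1 i * h1 j))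
    (hmτ : ∀ (g h : B) (n m : ℕ) (g1 g2 : Fin n → B) (h1 h2 : Fin m → B),
      Coalgebra.comul (R := k) g = ∑ i, g1 i ⊗ₜ[k] g2 i →
      Coalgebra.comul (R := k) h = ∑ j, h1 j ⊗ₜ[k] h2 j →
      mτ (g ⊗ₜ[k] h) = ∑ i, ∑ j, τ (g2 i ⊗ₜ[k] h2 j) • (g1 i * h1 j)) :
    -- `φ = id ∗ β` is an isomorphism of left `B`-comodule algebras `B_τ → B_σ`
    (∀ g h : B, convWith β (mτ (g ⊗ₜ[k] h)) = mσ (convWith β g ⊗ₜ[k] convWith β h)) ∧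
    (convWith β (1 : B) = 1) ∧
    Function.Bijective (convWith (k := k) (B := B) β) ∧
    (∀ h : B, convWith βinv (convWith β h) = h) ∧
    (∀ h : B, convWith β (convWith βinv h) = h) ∧
    (∀ h : B, Coalgebra.comul (R := k) (convWith β h)
        = LinearMap.lTensor B (convWith β) (Coalgebra.comul (R := k) h)) := by
  have hcw : ∀ s : B →ₗ[k] k, convWith s = cw s := fun _ => rfl
  simp only [hcw]
  have hinv1 : βinv ∘ₗ cw β = Coalgebra.counit (R := k) := by
    ext c
    obtain ⟨n, c1, c2, hc⟩ := exists_fin (k := k) c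
    rw [← (hβinv c n c1 c2 hc).2, LinearMap.comp_apply, cw_sum β c c1 c2 hc]
    simp [mul_comm]
  have hinv2 : β ∘ₗ cw βinv = Coalgebra.counit (R := k) := by
    ext c
    obtain ⟨n, c1, c2, hc⟩ := exists_fin (k := k) c
    rw [← (hβinv c n c1 c2 hc).1, LinearMap.comp_apply, cw_sum βinv c c1 c2 hc]
    simp [mul_comm]
  have hl : ∀ h : B, cw βinv (cw β h) = h := by
    intro h; rw [cw_cw, hinv1, cw_counit]
  have hr : ∀ h : B, cw β (cw βinv h) = h := by
    intro h; rw [cw_cw, hinv2, cw_counit]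
  have hmσ' : mσ = LinearMap.mul' k B ∘ₗ cw σ := by
    ext a b
    obtain ⟨n, c1, c2, hc⟩ := exists_fin (k := k) a
    obtain ⟨m, d1, d2, hd⟩ := exists_fin (k := k) b
    simp [hmσ a b n m c1 c2 d1 d2 hc hd, cw_sum_tmul σ a b c1 c2 d1 d2 hc hd]
  have hmτ' : mτ = LinearMap.mul' k B ∘ₗ cw τ := by
    ext a b
    obtain ⟨n, c1, c2, hc⟩ := exists_fin (k := k) a
    obtain ⟨m, d1, d2, hd⟩ := exists_fin (k := k) b
    simp [hmτ a b n m c1 c2 d1 d2 hc hd, cw_sum_tmul τ a b c1 c2 d1 d2 hc hd]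
  have hτ' : τ = (βinv ∘ₗ LinearMap.mul' k B) ∘ₗ cw (σ ∘ₗ cw (ff β β)) := by
    ext a b
    obtain ⟨n, c1, c2, hc⟩ := exists_fin (k := k) a
    obtain ⟨m, d1, d2, hd⟩ := exists_fin (k := k) b
    choose p cc1 cc2 hcc using fun i => exists_fin (k := k) (c2 i)
    choose q dd1 dd2 hdd using fun i => exists_fin (k := k) (d2 i)
    have e : ∀ i j, cw (ff β β) (c2 i ⊗ₜ[k] d2 j) = _ := fun i j =>
      cw_sum_tmul (ff β β) (c2 i) (d2 j) _ _ _ _ (hcc i) (hdd j)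
    simp only [TensorProduct.AlgebraTensorModule.curry_apply, TensorProduct.curry_apply,
      LinearMap.restrictScalars_self, LinearMap.comp_apply]
    rw [hτ a b n c1 c2 p cc1 cc2 m d1 d2 q dd1 dd2 hc hcc hd hdd,
      cw_sum_tmul _ a b c1 c2 d1 d2 hc hd]
    simp only [LinearMap.comp_apply, e, map_sum, map_smul]
    simp only [LinearMap.comp_apply, smul_eq_mul, ff,
      TensorProduct.map_tmul, LinearMap.mul'_apply, Finset.sum_mul]
    refine Finset.sum_congr rfl fun i _ => ?_
    rw [Finset.sum_comm]
    refine Finset.sum_congr rfl fun j _ => ?_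
    refine Finset.sum_congr rfl fun i' _ => ?_
    refine Finset.sum_congr rfl fun j' _ => ?_
    ring
  refine ⟨fun g h => ?_, ?_, ⟨Function.LeftInverse.injective hl,
    Function.RightInverse.surjective hr⟩, hl, hr, cw_comul β⟩
  · rw [hmτ', hmσ', ← cw_ff, LinearMap.comp_apply, LinearMap.comp_apply, cw_cw, hτ', ← cw_cw,
      ← cw_map (LinearMap.mul' k B) comul_mul', hr]
  · simp [cw, hβ1, Algebra.TensorProduct.one_def]

end
end
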